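/- Let s > 1/2 and let K ∈ 𝒮'(ℝ^{2d}) be a tempered distribution. Let 𝒦 : 𝒮'(ℝ^d) → 𝒮'(ℝ^d) be a (weak-* sequentially) continuous linear operator such that: (i) for all f, h ∈ Σ_s(ℝ^d) one has ⟨𝒦f, h⟩ = ⟨K, h ⊗ f⟩, where h ⊗ f(x,y) := h(x) f(y) and ⟨·,·⟩ denotes the bilinear pairing of a tempered distribution with a Schwartz function; (ii) 𝒦 maps Σ_s(ℝ^d) into Σ_s(ℝ^d); (iii) WF₁^s(K) = ∅ and WF₂^s(K) = ∅, where, writing points of ℝ^{4d} as (x,y,ξ,η), WF₁^s(K) := { (x,ξ) : (x,0,ξ,0) ∈ WF^s(K) } and WF₂^s(K) := { (y,η) : (0,y,0,−η) ∈ WF^s(K) }. Then for every u ∈ 𝒮'(ℝ^d), WF^s(𝒦u) ⊆ WF^s(K)' ∘ WF^s(u) := { (x,ξ) ∈ ℝ^{2d} \ {0} : there exists (y,η) ∈ WF^s(u) with (x,y,ξ,−η) ∈ WF^s(K) }. -/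

import Mathlib

open MeasureTheory Filter
open scoped BigOperators ENNReal RealInnerProductSpace

noncomputable section

/-- `ℝ^d` with the Euclidean norm. -/
abbrev Ed (d : ℕ) : Type := EuclideanSpace ℝ (Fin d)

/-- Partial derivative along the `i`-th coordinate direction. -/
def pdGS {d : ℕ} (i : Fin d) (f : Ed d → ℂ) : Ed d → ℂ :=
  fun x => fderiv ℝ f x (EuclideanSpace.single i 1)

/-- Multi-index partial derivative `∂^β`. -/
def mderiv {d : ℕ} (β : Fin d → ℕ) (f : Ed d → ℂ) : Ed d → ℂ :=
  ((List.ofFn fun i : Fin d => (pdGS i)^[β i]).foldr (· ∘ ·) id) f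

/-- Monomial `x^α`. -/
def mpow {d : ℕ} (x : Ed d) (α : Fin d → ℕ) : ℝ := ∏ i, x i ^ α i

/-- Multi-index factorial `α!`. -/
def mfact {d : ℕ} (α : Fin d → ℕ) : ℕ := ∏ i, Nat.factorial (α i)

/-- Multi-index length `|α|`. -/
def mlen {d : ℕ} (α : Fin d → ℕ) : ℕ := ∑ i, α i

/-- The Gelfand–Shilov seminorm `‖f‖_{S_{s,h}}`, valued in `[0,∞]`. -/
def GSnorm {d : ℕ} (s h : ℝ) (f : Ed d → ℂ) : ℝ≥0∞ :=
  ⨆ (x : Ed d) (α : Fin d → ℕ) (β : Fin d → ℕ),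
    ENNReal.ofReal (|mpow x α| * ‖mderiv β f x‖ /
      (h ^ (mlen α + mlen β) * ((mfact α : ℝ) * (mfact β : ℝ)) ^ s))

/-- The Gelfand–Shilov space `Σ_s(ℝ^d)`: smooth functions all of whose
`S_{s,h}` seminorms are finite. -/
def SigmaGS (s : ℝ) (d : ℕ) : Set (Ed d → ℂ) :=
  {f | ContDiff ℝ ((⊤ : ℕ∞) : WithTop ℕ∞) f ∧ ∀ h : ℝ, 0 < h → GSnorm s h f < ⊤}

/-- The seminorm `|f|_A`, valued in `[0,∞]`. -/
def GSnormA {d : ℕ} (s A : ℝ) (f : Ed d → ℂ) : ℝ≥0∞ :=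
  ⨆ (x : Ed d) (β : Fin d → ℕ),
    ENNReal.ofReal (A ^ mlen β * Real.exp (A * ‖x‖ ^ (1/s)) * ‖mderiv β f x‖ /
      (mfact β : ℝ) ^ s)

/-- The Fourier transform `f̂(ξ) = ∫ f(x) e^{-i⟨x,ξ⟩} dx`. -/
def FTgs {d : ℕ} (f : Ed d → ℂ) (ξ : Ed d) : ℂ :=
  ∫ x : Ed d, f x * Complex.exp (-(Complex.I * (⟪x, ξ⟫ : ℝ)))

/-- The short-time Fourier transform of a function `f` with window `φ`. -/
def STFTgs {d : ℕ} (φ f : Ed d → ℂ) (z : Ed d × Ed d) : ℂ :=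
  ∫ y : Ed d, f y * (starRingEnd ℂ) (φ (y - z.1)) * Complex.exp (-(Complex.I * (⟪y, z.2⟫ : ℝ)))

/-- Euclidean norm of a phase-space point `(x,ξ) ∈ ℝ^{2d}`. -/
def pnorm {d : ℕ} (z : Ed d × Ed d) : ℝ := Real.sqrt (‖z.1‖ ^ 2 + ‖z.2‖ ^ 2)

/-- A conic subset: invariant under multiplication by positive reals. -/
def IsConic {V : Type*} [SMul ℝ V] (Γ : Set V) : Prop :=
  ∀ t : ℝ, 0 < t → ∀ z ∈ Γ, t • z ∈ Γ

/-- Tempered distributions on `ℝ^d`. -/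
abbrev TD (d : ℕ) : Type := SchwartzMap (Ed d) ℂ →L[ℂ] ℂ

/-- `W` is the short-time Fourier transform `V_φ u` of the tempered distribution `u`
with respect to the window `φ`. -/
def IsSTFT {d : ℕ} (u : TD d) (φ : Ed d → ℂ) (W : Ed d × Ed d → ℂ) : Prop :=
  ∀ (x ξ : Ed d) (g : SchwartzMap (Ed d) ℂ),
    (∀ y : Ed d, g y = (starRingEnd ℂ) (φ (y - x)) * Complex.exp (-(Complex.I * (⟪y, ξ⟫ : ℝ)))) →
    W (x, ξ) = u g

/-- The `s`-Gelfand–Shilov wave front set of a distribution whose short-time Fourier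
transform is `W`: the set of nonzero phase-space points having no open conic
neighbourhood on which `e^{A|z|^{1/s}} |W(z)|` is bounded for every `A > 0`. -/
def WFs {d : ℕ} (s : ℝ) (W : Ed d × Ed d → ℂ) : Set (Ed d × Ed d) :=
  {z₀ | z₀ ≠ 0 ∧ ¬ ∃ Γ : Set (Ed d × Ed d), IsOpen Γ ∧ IsConic Γ ∧
    (0 : Ed d × Ed d) ∉ Γ ∧ z₀ ∈ Γ ∧
    ∀ A : ℝ, 0 < A → ∃ C : ℝ, ∀ z ∈ Γ, Real.exp (A * pnorm z ^ (1/s)) * ‖W z‖ ≤ C}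

/-- The real quadratic form `⟨Bx, x⟩` of a matrix `B`. -/
def qf {d : ℕ} (B : Matrix (Fin d) (Fin d) ℝ) (x : Ed d) : ℝ :=
  ∑ i, (∑ j, B i j * x j) * x i

/-- Tempered distributions on `ℝ^m × ℝ^n`. -/
abbrev TD2 (m n : ℕ) : Type := SchwartzMap (Ed m × Ed n) ℂ →L[ℂ] ℂ

/-- Short-time Fourier transform of a tempered distribution on `ℝ^m × ℝ^n`. -/
def IsSTFT2 {m n : ℕ} (w : TD2 m n) (Φ : Ed m × Ed n → ℂ)
    (W : (Ed m × Ed n) × (Ed m × Ed n) → ℂ) : Prop :=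
  ∀ (x ξ : Ed m × Ed n) (g : SchwartzMap (Ed m × Ed n) ℂ),
    (∀ y : Ed m × Ed n, g y = (starRingEnd ℂ) (Φ (y - x)) *
      Complex.exp (-(Complex.I * ((⟪y.1, ξ.1⟫ + ⟪y.2, ξ.2⟫ : ℝ))))) →
    W (x, ξ) = w g

/-- Euclidean norm of a phase-space point of `T^*(ℝ^m × ℝ^n)`. -/
def pnorm2 {m n : ℕ} (z : (Ed m × Ed n) × (Ed m × Ed n)) : ℝ :=
  Real.sqrt (‖z.1.1‖ ^ 2 + ‖z.1.2‖ ^ 2 + ‖z.2.1‖ ^ 2 + ‖z.2.2‖ ^ 2)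

/-- The `s`-Gelfand–Shilov wave front set on `ℝ^m × ℝ^n`. -/
def WFs2 {m n : ℕ} (s : ℝ) (W : (Ed m × Ed n) × (Ed m × Ed n) → ℂ) :
    Set ((Ed m × Ed n) × (Ed m × Ed n)) :=
  {z₀ | z₀ ≠ 0 ∧ ¬ ∃ Γ : Set ((Ed m × Ed n) × (Ed m × Ed n)), IsOpen Γ ∧ IsConic Γ ∧
    (0 : (Ed m × Ed n) × (Ed m × Ed n)) ∉ Γ ∧ z₀ ∈ Γ ∧
    ∀ A : ℝ, 0 < A → ∃ C : ℝ, ∀ z ∈ Γ, Real.exp (A * pnorm2 z ^ (1/s)) * ‖W z‖ ≤ C}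

namespace GelfandShilov

open scoped Topology Pointwise SchwartzMap ContDiff

/-! ### Superexponential weights -/

lemma exp_decay_of_pow_mul_le {s : ℝ} (hs : 0 < s) {a t C h : ℝ} (ha : 0 ≤ a) (ht : 0 ≤ t)
    (hC : 0 ≤ C) (hh : 0 < h)
    (H : ∀ k : ℕ, t ^ k * a ≤ C * (h ^ k * (k.factorial : ℝ) ^ s)) :
    a ≤ 2 ^ s * C * Real.exp (-(s / 2 * (t / h) ^ (1 / s))) := by
  set τ := t / h with hτ
  have hτ0 : 0 ≤ τ := by positivity
  set σ := 1 / s with hσ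
  have hσ0 : 0 < σ := by positivity
  have h1 : ∀ k : ℕ, (τ ^ σ / 2) ^ k / (k.factorial : ℝ) * a ^ σ ≤ C ^ σ * (1 / 2) ^ k := by
    intro k
    have hk : (0 : ℝ) < k.factorial := by exact_mod_cast k.factorial_pos
    have h2 : τ ^ k * a ≤ C * (k.factorial : ℝ) ^ s := by
      have := H k
      rw [hτ, div_pow, div_mul_eq_mul_div, div_le_iff₀ (by positivity)]
      linarith
    have h3 : (τ ^ k * a) ^ σ ≤ (C * (k.factorial : ℝ) ^ s) ^ σ :=
      Real.rpow_le_rpow (by positivity) h2 hσ0.le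
    rw [Real.mul_rpow (by positivity) ha, Real.mul_rpow hC (by positivity),
      ← Real.rpow_mul hk.le, hσ, mul_one_div_cancel hs.ne', Real.rpow_one, ← hσ,
      ← Real.rpow_natCast, ← Real.rpow_mul hτ0, mul_comm (k : ℝ) σ, Real.rpow_mul hτ0,
      Real.rpow_natCast] at h3
    rw [div_pow, one_div, inv_pow]
    rw [div_div, div_mul_eq_mul_div, div_le_iff₀ (by positivity)]
    calc _ ≤ _ := h3
      _ = _ := by field_simp
  have h4 : Real.exp (τ ^ σ / 2) * a ^ σ ≤ C ^ σ * 2 := by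
    have e1 : HasSum (fun k : ℕ => (τ ^ σ / 2) ^ k / (k.factorial : ℝ) * a ^ σ)
        (Real.exp (τ ^ σ / 2) * a ^ σ) := by
      apply HasSum.mul_right
      rw [Real.exp_eq_exp_ℝ]
      exact NormedSpace.expSeries_div_hasSum_exp (τ ^ σ / 2)
    have e2 : HasSum (fun k : ℕ => C ^ σ * (1 / 2 : ℝ) ^ k) (C ^ σ * 2) :=
      HasSum.mul_left _ hasSum_geometric_two
    exact hasSum_le h1 e1 e2
  have h5 := Real.rpow_le_rpow (by positivity) h4 hs.le
  rw [Real.mul_rpow (by positivity) (by positivity), Real.mul_rpow (by positivity) (by positivity),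
    ← Real.rpow_mul ha, ← Real.rpow_mul hC, hσ, one_div_mul_cancel hs.ne', Real.rpow_one,
    Real.rpow_one, ← Real.exp_mul, ← hσ] at h5
  rw [Real.exp_neg, ← div_eq_mul_inv, le_div_iff₀ (Real.exp_pos _)]
  calc a * Real.exp (s / 2 * τ ^ σ) = Real.exp (τ ^ σ / 2 * s) * a := by
        rw [mul_comm]; congr 2; ring
    _ ≤ _ := h5
    _ = _ := by ring

lemma one_add_pow_le_exp {σ A : ℝ} (hσ : 0 < σ) (hA : 0 < A) (N : ℕ) :
    ∃ C : ℝ, 0 < C ∧ ∀ t : ℝ, 0 ≤ t → (1 + t) ^ N ≤ C * Real.exp (A * t ^ σ) := by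
  obtain ⟨M, hM⟩ := exists_nat_ge ((N : ℝ) / σ)
  have hM' : (N : ℝ) ≤ σ * M := by rwa [div_le_iff₀ hσ, mul_comm] at hM
  refine ⟨2 ^ N + 2 ^ N * (M.factorial / A ^ M), by positivity, fun t ht => ?_⟩
  rcases le_total t 1 with h | h
  · calc (1 + t) ^ N ≤ 2 ^ N := by gcongr; linarith
      _ = 2 ^ N * 1 := by ring
      _ ≤ (2 ^ N + 2 ^ N * (M.factorial / A ^ M)) * Real.exp (A * t ^ σ) := by
        gcongr
        · have : (0 : ℝ) ≤ 2 ^ N * (M.factorial / A ^ M) := by positivity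
          linarith
        · apply Real.one_le_exp; positivity
  · have h1 : (A * t ^ σ) ^ M / M.factorial ≤ Real.exp (A * t ^ σ) :=
      Real.pow_div_factorial_le_exp _ (by positivity) M
    have h2 : t ^ N ≤ (t ^ σ) ^ M := by
      rw [← Real.rpow_natCast, ← Real.rpow_natCast, ← Real.rpow_mul ht]
      exact Real.rpow_le_rpow_of_exponent_le h hM'
    have hf : (0 : ℝ) < M.factorial := by exact_mod_cast M.factorial_pos
    calc (1 + t) ^ N ≤ (2 * t) ^ N := by gcongr; linarith
      _ = 2 ^ N * t ^ N := mul_pow _ _ _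
      _ ≤ 2 ^ N * (t ^ σ) ^ M := by gcongr
      _ = 2 ^ N * (M.factorial / A ^ M) * ((A * t ^ σ) ^ M / M.factorial) := by
        rw [mul_pow]; field_simp
      _ ≤ 2 ^ N * (M.factorial / A ^ M) * Real.exp (A * t ^ σ) := by gcongr
      _ ≤ _ := by
        gcongr
        have : (0 : ℝ) ≤ 2 ^ N := by positivity
        linarith

section Integrable
variable {V : Type*} [NormedAddCommGroup V] [NormedSpace ℝ V] [FiniteDimensional ℝ V]
  [MeasurableSpace V] [BorelSpace V] (μ : Measure V) [μ.IsAddHaarMeasure]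

lemma integrable_inv_one_add_pow :
    Integrable (fun w : V => ((1 + ‖w‖) ^ (Module.finrank ℝ V + 1))⁻¹) μ := by
  have := integrable_one_add_norm (E := V) (μ := μ) (r := (Module.finrank ℝ V + 1 : ℕ))
    (by push_cast; linarith)
  refine this.congr (Eventually.of_forall fun w => ?_)
  simp only
  rw [Real.rpow_neg (by positivity), Real.rpow_natCast]

lemma integrable_exp_neg_norm_rpow {σ A : ℝ} (hσ : 0 < σ) (hA : 0 < A) :
    Integrable (fun w : V => Real.exp (-(A * ‖w‖ ^ σ))) μ := by
  obtain ⟨C, hC, h⟩ := one_add_pow_le_exp hσ hA (Module.finrank ℝ V + 1)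
  refine ((integrable_inv_one_add_pow μ).const_mul C).mono' ?_ (Eventually.of_forall fun w => ?_)
  · apply Continuous.aestronglyMeasurable
    have : Continuous fun w : V => ‖w‖ ^ σ :=
      continuous_norm.rpow_const fun _ => Or.inr hσ.le
    fun_prop
  · rw [Real.norm_of_nonneg (Real.exp_pos _).le, Real.exp_neg, ← div_eq_mul_inv,
      inv_eq_one_div, div_le_div_iff₀ (Real.exp_pos _) (by positivity), one_mul]
    exact h _ (norm_nonneg _)

end Integrable

/-! ### Conic neighbourhoods -/

/-- `f` decays faster than `exp (-A r ^ σ)`, for every `A`, along the rays through `N`. -/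
def RayDecay {X : Type*} [SMul ℝ X] (σ : ℝ) (f : X → ℝ) (N : Set X) : Prop :=
  ∀ A : ℝ, 0 < A → ∃ C : ℝ, ∀ r : ℝ, 0 < r → ∀ p ∈ N, Real.exp (A * r ^ σ) * f (r • p) ≤ C

lemma RayDecay.mono {X : Type*} [SMul ℝ X] {σ : ℝ} {f : X → ℝ} {N N' : Set X}
    (h : RayDecay σ f N) (hN : N' ⊆ N) : RayDecay σ f N' := fun A hA => by
  obtain ⟨C, hC⟩ := h A hA
  exact ⟨C, fun r hr p hp => hC r hr p (hN hp)⟩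

lemma RayDecay.mul_poly {X : Type*} [SMul ℝ X] {σ : ℝ} (hσ : 0 < σ) {f g : X → ℝ} {N : Set X}
    (hf0 : ∀ p, 0 ≤ f p) (hf : RayDecay σ f N)
    (hg : ∃ (C : ℝ) (k : ℕ), ∀ r : ℝ, 0 < r → ∀ p ∈ N, g (r • p) ≤ C * (1 + r) ^ k) :
    RayDecay σ (fun p => f p * g p) N := by
  intro A hA
  obtain ⟨C, k, hC⟩ := hg
  obtain ⟨C1, hC10, hC1⟩ := one_add_pow_le_exp hσ one_pos k
  obtain ⟨C2, hC2⟩ := hf (A + 1) (by linarith)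
  refine ⟨C2 * (|C| * C1), fun r hr p hp => ?_⟩
  have h1 : g (r • p) ≤ |C| * (C1 * Real.exp (1 * r ^ σ)) :=
    calc g (r • p) ≤ C * (1 + r) ^ k := hC r hr p hp
      _ ≤ |C| * (1 + r) ^ k := by gcongr; exact le_abs_self C
      _ ≤ _ := by gcongr; exact hC1 r hr.le
  have h2 := hC2 r hr p hp
  have h3 : Real.exp ((A + 1) * r ^ σ) = Real.exp (A * r ^ σ) * Real.exp (1 * r ^ σ) := by
    rw [← Real.exp_add]; congr 1; ring
  have hf' := hf0 (r • p)
  calc Real.exp (A * r ^ σ) * (f (r • p) * g (r • p))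
      ≤ Real.exp (A * r ^ σ) * (f (r • p) * (|C| * (C1 * Real.exp (1 * r ^ σ)))) := by gcongr
    _ = Real.exp ((A + 1) * r ^ σ) * f (r • p) * (|C| * C1) := by rw [h3]; ring
    _ ≤ _ := by gcongr

lemma RayDecay.of_exp_bound {X : Type*} [SMul ℝ X] {σ δ : ℝ} (hσ : 0 < σ) (hδ : 0 < δ)
    {f : X → ℝ} {N : Set X} (hf0 : ∀ p, 0 ≤ f p) (P : X → ℝ)
    (hf : ∀ A : ℝ, 0 < A → ∃ C : ℝ, ∀ r : ℝ, 0 < r → ∀ p ∈ N,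
      Real.exp (A * P (r • p) ^ σ) * f (r • p) ≤ C)
    (hP : ∀ r : ℝ, 0 < r → ∀ p ∈ N, r * δ ≤ P (r • p)) : RayDecay σ f N := by
  intro A hA
  obtain ⟨C, hC⟩ := hf (A / δ ^ σ) (by positivity)
  refine ⟨C, fun r hr p hp => le_trans ?_ (hC r hr p hp)⟩
  apply mul_le_mul_of_nonneg_right (Real.exp_le_exp.2 ?_) (hf0 (r • p))
  calc A * r ^ σ = A / δ ^ σ * (r * δ) ^ σ := by
        rw [Real.mul_rpow hr.le hδ.le]; field_simp
    _ ≤ _ := by gcongr; exact hP r hr p hp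

lemma exists_rayDecay_nhds_of_conic {X : Type*} [NormedAddCommGroup X] [NormedSpace ℝ X]
    {σ : ℝ} (hσ : 0 < σ) {f : X → ℝ} (hf0 : ∀ p, 0 ≤ f p) {P : X → ℝ} (hP : ∀ p, ‖p‖ ≤ P p)
    {z₀ : X} (hz : z₀ ≠ 0) {Γ : Set X} (hΓ : IsOpen Γ) (hcone : IsConic Γ) (hmem : z₀ ∈ Γ)
    (hdec : ∀ A : ℝ, 0 < A → ∃ C : ℝ, ∀ z ∈ Γ, Real.exp (A * P z ^ σ) * f z ≤ C) :
    ∃ N ∈ 𝓝 z₀, RayDecay σ f N := by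
  have hz' : 0 < ‖z₀‖ := norm_pos_iff.2 hz
  refine ⟨Γ ∩ {z | ‖z₀‖ / 2 < ‖z‖}, inter_mem (hΓ.mem_nhds hmem)
    ((isOpen_lt continuous_const continuous_norm).mem_nhds (by
      simp only [Set.mem_ofPred_eq]; linarith)), ?_⟩
  refine RayDecay.of_exp_bound hσ (half_pos hz') hf0 P (fun A hA => ?_) ?_
  · obtain ⟨C, hC⟩ := hdec A hA
    exact ⟨C, fun r hr p hp => hC _ (hcone r hr p hp.1)⟩
  · intro r hr p hp
    refine le_trans ?_ (hP _)
    rw [norm_smul, Real.norm_of_nonneg hr.le]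
    have := hp.2
    simp only [Set.mem_ofPred_eq] at this
    gcongr

lemma norm_le_pnorm {d : ℕ} (z : Ed d × Ed d) : ‖z‖ ≤ pnorm z := by
  rw [Prod.norm_def]
  apply max_le <;> apply Real.le_sqrt_of_sq_le <;> nlinarith [sq_nonneg ‖z.1‖, sq_nonneg ‖z.2‖]

lemma pnorm_le_two_mul_norm {d : ℕ} (z : Ed d × Ed d) : pnorm z ≤ 2 * ‖z‖ := by
  have h1 : ‖z.1‖ ≤ ‖z‖ := norm_fst_le z
  have h2 : ‖z.2‖ ≤ ‖z‖ := norm_snd_le z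
  apply Real.sqrt_le_iff.2
  refine ⟨by positivity, ?_⟩
  nlinarith [norm_nonneg z.1, norm_nonneg z.2, norm_nonneg z]

lemma norm_le_pnorm2 {m n : ℕ} (z : (Ed m × Ed n) × (Ed m × Ed n)) : ‖z‖ ≤ pnorm2 z := by
  rw [Prod.norm_def, Prod.norm_def, Prod.norm_def]
  refine max_le (max_le ?_ ?_) (max_le ?_ ?_) <;> apply Real.le_sqrt_of_sq_le <;>
    nlinarith [sq_nonneg ‖z.1.1‖, sq_nonneg ‖z.2.1‖, sq_nonneg ‖z.1.2‖, sq_nonneg ‖z.2.2‖]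

lemma exists_rayDecay_of_notMem_WFs {d : ℕ} {s : ℝ} (hs : 0 < s) {W : Ed d × Ed d → ℂ}
    {z₀ : Ed d × Ed d} (hz : z₀ ≠ 0) (h : z₀ ∉ WFs s W) :
    ∃ N ∈ 𝓝 z₀, RayDecay (1 / s) (fun z => ‖W z‖) N := by
  simp only [WFs, Set.mem_ofPred_eq, not_and, not_not] at h
  obtain ⟨Γ, h1, h2, -, h4, h5⟩ := h hz
  exact exists_rayDecay_nhds_of_conic (by positivity) (fun _ => norm_nonneg _) norm_le_pnorm hz
    h1 h2 h4 h5

lemma exists_rayDecay_of_notMem_WFs2 {m n : ℕ} {s : ℝ} (hs : 0 < s)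
    {W : (Ed m × Ed n) × (Ed m × Ed n) → ℂ}
    {z₀ : (Ed m × Ed n) × (Ed m × Ed n)} (hz : z₀ ≠ 0) (h : z₀ ∉ WFs2 s W) :
    ∃ N ∈ 𝓝 z₀, RayDecay (1 / s) (fun z => ‖W z‖) N := by
  simp only [WFs2, Set.mem_ofPred_eq, not_and, not_not] at h
  obtain ⟨Γ, h1, h2, -, h4, h5⟩ := h hz
  exact exists_rayDecay_nhds_of_conic (by positivity) (fun _ => norm_nonneg _) norm_le_pnorm2 hz
    h1 h2 h4 h5

lemma exists_nhds_uniform_decay {V W : Type*} [NormedAddCommGroup V] [NormedSpace ℝ V]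
    [NormedAddCommGroup W] [NormedSpace ℝ W] [ProperSpace W] {σ : ℝ}
    (G : V × W → ℝ) (z₀ : V)
    (hloc : ∀ t : ℝ, 0 ≤ t → ∀ w : W, (t ≠ 0 ∨ w ≠ 0) →
      ∃ N ∈ 𝓝 (t • z₀, w), RayDecay σ G N) :
    ∃ U ∈ 𝓝 z₀, ∀ A : ℝ, 0 < A → ∃ C : ℝ, ∀ r : ℝ, 0 < r → ∀ z ∈ U, ∀ w : W,
      Real.exp (A * (max r ‖w‖) ^ σ) * G (r • z, w) ≤ C := by
  set Q : Set (ℝ × W) := {q | q ∈ Set.Icc (0 : ℝ) 1 ×ˢ Metric.closedBall (0 : W) 1 ∧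
    max q.1 ‖q.2‖ = 1} with hQ
  have hQc : IsCompact Q := by
    apply (isCompact_Icc.prod (isCompact_closedBall (0 : W) 1)).inter_right
    exact isClosed_eq (by fun_prop) continuous_const
  have key : ∃ U ∈ 𝓝 z₀, ∀ A : ℝ, 0 < A → ∃ C : ℝ, ∀ r : ℝ, 0 < r → ∀ z ∈ U, ∀ q ∈ Q,
      Real.exp (A * r ^ σ) * G (r • (q.1 • z), r • q.2) ≤ C := by
    refine IsCompact.induction_on (p := fun S => ∃ U ∈ 𝓝 z₀, ∀ A : ℝ, 0 < A → ∃ C : ℝ,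
      ∀ r : ℝ, 0 < r → ∀ z ∈ U, ∀ q ∈ S,
        Real.exp (A * r ^ σ) * G (r • (q.1 • z), r • q.2) ≤ C) hQc ?_ ?_ ?_ ?_
    · exact ⟨Set.univ, univ_mem, fun A _ => ⟨0, by simp⟩⟩
    · intro S T hST hT
      obtain ⟨U, hU, h⟩ := hT
      refine ⟨U, hU, fun A hA => ?_⟩
      obtain ⟨C, hC⟩ := h A hA
      exact ⟨C, fun r hr z hz q hq => hC r hr z hz q (hST hq)⟩
    · intro S T hS hT
      obtain ⟨U, hU, h⟩ := hS
      obtain ⟨U', hU', h'⟩ := hT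
      refine ⟨U ∩ U', inter_mem hU hU', fun A hA => ?_⟩
      obtain ⟨C, hC⟩ := h A hA
      obtain ⟨C', hC'⟩ := h' A hA
      refine ⟨max C C', fun r hr z hz q hq => ?_⟩
      rcases hq with hq | hq
      · exact (hC r hr z hz.1 q hq).trans (le_max_left _ _)
      · exact (hC' r hr z hz.2 q hq).trans (le_max_right _ _)
    · intro q hq
      have hne : q.1 ≠ 0 ∨ q.2 ≠ 0 := by
        by_contra! hcon
        have := hq.2
        simp [hcon.1, hcon.2] at this
      obtain ⟨N, hN, hdec⟩ := hloc q.1 hq.1.1.1 q.2 hne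
      have hcont : ContinuousAt (fun x : V × (ℝ × W) => (x.2.1 • x.1, x.2.2)) (z₀, q) := by
        fun_prop
      have := hcont.preimage_mem_nhds hN
      rw [nhds_prod_eq] at this
      obtain ⟨U, hU, S, hS, hUS⟩ := Filter.mem_prod_iff.1 this
      refine ⟨S, mem_nhdsWithin_of_mem_nhds hS, U, hU, fun A hA => ?_⟩
      obtain ⟨C, hC⟩ := hdec A hA
      refine ⟨C, fun r hr z hz q' hq' => ?_⟩
      exact hC r hr _ (hUS (Set.mk_mem_prod hz hq'))
  obtain ⟨U, hU, h⟩ := key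
  refine ⟨U, hU, fun A hA => ?_⟩
  obtain ⟨C, hC⟩ := h A hA
  refine ⟨C, fun r hr z hz w => ?_⟩
  set l := max r ‖w‖ with hl
  have hl0 : 0 < l := lt_max_of_lt_left hr
  have hrl : r ≤ l := le_max_left _ _
  have hwl : ‖w‖ ≤ l := le_max_right _ _
  have hnw : ‖l⁻¹ • w‖ = ‖w‖ / l := by
    rw [norm_smul, norm_inv, Real.norm_of_nonneg hl0.le]; ring
  have hq : ((r / l, l⁻¹ • w) : ℝ × W) ∈ Q := by
    refine ⟨⟨⟨by positivity, (div_le_one hl0).2 hrl⟩, ?_⟩, ?_⟩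
    · simp only [Metric.mem_closedBall, dist_zero_right]
      rw [hnw]; exact (div_le_one hl0).2 hwl
    · simp only
      rw [hnw, max_div_div_right hl0.le, ← hl, div_self hl0.ne']
  have := hC l hl0 z hz _ hq
  simp only at this
  rwa [smul_smul, smul_smul, mul_div_cancel₀ _ hl0.ne', mul_inv_cancel₀ hl0.ne', one_smul] at this

lemma notMem_WFs_of_le_integral {d : ℕ} {W : Type*} [NormedAddCommGroup W] [NormedSpace ℝ W]
    [FiniteDimensional ℝ W] [MeasurableSpace W] [BorelSpace W] (μ : Measure W) [μ.IsAddHaarMeasure]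
    {s : ℝ} (hs : 0 < s) (b : Ed d × Ed d → ℂ) (G : (Ed d × Ed d) × W → ℝ)
    (hG0 : ∀ p, 0 ≤ G p) (c : ℝ)
    (hb : ∀ z (B : W → ℝ), Integrable B μ → (∀ w, G (z, w) ≤ B w) → ‖b z‖ ≤ c * ∫ w, B w ∂μ)
    {z₀ : Ed d × Ed d}
    (hloc : ∀ t : ℝ, 0 ≤ t → ∀ w : W, (t ≠ 0 ∨ w ≠ 0) →
      ∃ N ∈ 𝓝 (t • z₀, w), RayDecay (1 / s) G N) :
    z₀ ∉ WFs s b := by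
  rintro ⟨hz0, hno⟩
  apply hno
  have : ProperSpace W := FiniteDimensional.proper ℝ W
  obtain ⟨U, hU, h⟩ := exists_nhds_uniform_decay G z₀ hloc
  have hU' : U ∩ {0}ᶜ ∩ Metric.ball z₀ 1 ∈ 𝓝 z₀ :=
    inter_mem (inter_mem hU (isOpen_compl_singleton.mem_nhds hz0)) (Metric.ball_mem_nhds _ one_pos)
  obtain ⟨O, hOU, hO, hzO⟩ := mem_nhds_iff.1 hU'
  set σ := 1 / s with hσ
  have hσ0 : 0 < σ := by positivity
  refine ⟨⋃ r : Set.Ioi (0 : ℝ), (r : ℝ) • O, ?_, ?_, ?_, ?_, ?_⟩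
  · exact isOpen_iUnion fun r => hO.smul₀ r.2.ne'
  · intro t ht z hz
    obtain ⟨r, hr⟩ := Set.mem_iUnion.1 hz
    obtain ⟨z', hz', rfl⟩ := hr
    refine Set.mem_iUnion.2 ⟨⟨t * r, mul_pos ht r.2⟩, z', hz', ?_⟩
    simp [mul_smul]
  · intro h0
    obtain ⟨r, hr⟩ := Set.mem_iUnion.1 h0
    obtain ⟨z', hz', h0'⟩ := hr
    have : z' = 0 := (smul_eq_zero.1 h0').resolve_left r.2.ne'
    exact (hOU hz').1.2 this
  · exact Set.mem_iUnion.2 ⟨⟨1, Set.mem_Ioi.2 one_pos⟩, z₀, hzO, by simp⟩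
  · intro A hA
    set M := 2 * (‖z₀‖ + 1) with hM
    have hM0 : 0 < M := by positivity
    set B := A * M ^ σ with hB
    have hB0 : 0 < B := by positivity
    obtain ⟨C, hC⟩ := h (2 * B) (by positivity)
    refine ⟨|c| * (|C| * ∫ w, Real.exp (-(B * ‖w‖ ^ σ)) ∂μ), fun z hz => ?_⟩
    obtain ⟨r, hr⟩ := Set.mem_iUnion.1 hz
    obtain ⟨z', hz', rfl⟩ := hr
    obtain ⟨r, hr0⟩ := r
    simp only
    have hr0' : 0 < r := hr0
    have hz'U := (hOU hz').1.1
    have hz'n : ‖z'‖ ≤ ‖z₀‖ + 1 := by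
      have := (hOU hz').2
      rw [Metric.mem_ball, dist_eq_norm] at this
      have h2 := norm_le_norm_add_norm_sub z₀ z'
      have h3 := norm_sub_rev z' z₀
      linarith
    have hp : pnorm (r • z') ≤ r * M := by
      refine (pnorm_le_two_mul_norm _).trans ?_
      rw [norm_smul, Real.norm_of_nonneg hr0'.le]
      nlinarith
    have hp0 : 0 ≤ pnorm (r • z') := Real.sqrt_nonneg _
    have hexp : Real.exp (A * pnorm (r • z') ^ σ) ≤ Real.exp (B * r ^ σ) := by
      apply Real.exp_le_exp.2
      calc A * pnorm (r • z') ^ σ ≤ A * (r * M) ^ σ := by gcongr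
        _ = _ := by rw [Real.mul_rpow hr0'.le hM0.le]; ring
    have hbound : ∀ w, G (r • z', w) ≤ |C| * Real.exp (-(B * r ^ σ)) *
        Real.exp (-(B * ‖w‖ ^ σ)) := by
      intro w
      have h1 := hC r hr0' z' hz'U w
      have h2 : Real.exp (B * r ^ σ) * Real.exp (B * ‖w‖ ^ σ) ≤
          Real.exp (2 * B * (max r ‖w‖) ^ σ) := by
        rw [← Real.exp_add]
        gcongr
        have e1 : r ^ σ ≤ (max r ‖w‖) ^ σ :=
          Real.rpow_le_rpow hr0'.le (le_max_left _ _) hσ0.le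
        have e2 : ‖w‖ ^ σ ≤ (max r ‖w‖) ^ σ :=
          Real.rpow_le_rpow (norm_nonneg _) (le_max_right _ _) hσ0.le
        nlinarith
      rw [Real.exp_neg, Real.exp_neg, mul_assoc, ← mul_inv, ← div_eq_mul_inv,
        le_div_iff₀ (by positivity)]
      calc G (r • z', w) * (Real.exp (B * r ^ σ) * Real.exp (B * ‖w‖ ^ σ))
          ≤ G (r • z', w) * Real.exp (2 * B * (max r ‖w‖) ^ σ) := by
            have := hG0 (r • z', w)
            gcongr
        _ ≤ C := by rw [mul_comm]; exact h1
        _ ≤ |C| := le_abs_self C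
    have hInt := hb (r • z') _ ((integrable_exp_neg_norm_rpow μ hσ0 hB0).const_mul
      (|C| * Real.exp (-(B * r ^ σ)))) hbound
    have hI0 : 0 ≤ ∫ w, Real.exp (-(B * ‖w‖ ^ σ)) ∂μ := integral_nonneg fun w => (Real.exp_pos _).le
    rw [integral_const_mul] at hInt
    calc Real.exp (A * pnorm (r • z') ^ σ) * ‖b (r • z')‖
        ≤ Real.exp (B * r ^ σ) * (|c| * (|C| * Real.exp (-(B * r ^ σ)) *
          ∫ w, Real.exp (-(B * ‖w‖ ^ σ)) ∂μ)) := by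
          gcongr
          exact hInt.trans (mul_le_mul_of_nonneg_right (le_abs_self c) (by positivity))
      _ = (Real.exp (B * r ^ σ) * Real.exp (-(B * r ^ σ))) *
          (|c| * (|C| * ∫ w, Real.exp (-(B * ‖w‖ ^ σ)) ∂μ)) := by ring
      _ = _ := by rw [← Real.exp_add, add_neg_cancel, Real.exp_zero, one_mul]

/-! ### Time-frequency shifts of a Schwartz function -/

lemma contDiff_cexp_neg_I_mul :
    ContDiff ℝ ∞ (fun t : ℝ => Complex.exp (-(Complex.I * (t : ℝ)))) := by
  have : ContDiff ℝ ∞ (fun t : ℝ => (t : ℂ)) := Complex.ofRealCLM.contDiff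
  fun_prop

lemma norm_iteratedFDeriv_cexp_neg_I_mul (n : ℕ) (t : ℝ) :
    ‖iteratedFDeriv ℝ n (fun t : ℝ => Complex.exp (-(Complex.I * (t : ℝ)))) t‖ = 1 := by
  have h0 : (fun t : ℝ => Complex.exp (-(Complex.I * (t : ℝ)))) =
      fun t : ℝ => Complex.exp ((-Complex.I) * (t : ℂ)) := by
    funext t; congr 1; ring
  have hd : ∀ n : ℕ, iteratedDeriv n (fun t : ℝ => Complex.exp ((-Complex.I) * (t : ℂ))) =
      fun t : ℝ => (-Complex.I) ^ n * Complex.exp ((-Complex.I) * (t : ℂ)) := by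
    intro n
    induction n with
    | zero => simp
    | succ n ih =>
      rw [iteratedDeriv_succ, ih]
      funext t
      have : HasDerivAt (fun t : ℝ => (-Complex.I) * (t : ℂ)) (-Complex.I) t := by
        simpa using (Complex.ofRealCLM.hasDerivAt (x := t)).const_mul (-Complex.I)
      rw [(this.cexp.const_mul ((-Complex.I) ^ n)).deriv]
      ring
  rw [norm_iteratedFDeriv_eq_norm_iteratedDeriv, h0, hd]
  simp only [norm_mul, norm_pow, norm_neg, Complex.norm_I, one_pow, one_mul]
  rw [Complex.norm_exp]
  simp

lemma hasTemperateGrowth_cexp_neg_I_mul :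
    Function.HasTemperateGrowth (fun t : ℝ => Complex.exp (-(Complex.I * (t : ℝ)))) :=
  ⟨contDiff_cexp_neg_I_mul, fun n => ⟨0, 1, fun t => by
    rw [norm_iteratedFDeriv_cexp_neg_I_mul]; simp⟩⟩

section Atom
variable {E : Type*} [NormedAddCommGroup E] [NormedSpace ℝ E]

/-- The function `(w, y) ↦ Φ (y - w.1) exp (-i B(y, w.2))`. -/
def atomFun (B : E →L[ℝ] E →L[ℝ] ℝ) (Φ : E → ℂ) (q : (E × E) × E) : ℂ :=
  Φ (q.2 - q.1.1) * Complex.exp (-(Complex.I * (B q.2 q.1.2 : ℝ)))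

lemma hasTemperateGrowth_phase (B : E →L[ℝ] E →L[ℝ] ℝ) :
    Function.HasTemperateGrowth
      (fun q : (E × E) × E => Complex.exp (-(Complex.I * (B q.2 q.1.2 : ℝ)))) := by
  have h1 : Function.HasTemperateGrowth (fun q : (E × E) × E => q.2) :=
    (ContinuousLinearMap.snd ℝ (E × E) E).hasTemperateGrowth
  have h2 : Function.HasTemperateGrowth (fun q : (E × E) × E => q.1.2) :=
    ((ContinuousLinearMap.snd ℝ E E).comp (ContinuousLinearMap.fst ℝ (E × E) E)).hasTemperateGrowth
  exact hasTemperateGrowth_cexp_neg_I_mul.comp (B.bilinear_hasTemperateGrowth h1 h2)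

lemma contDiff_atomFun (B : E →L[ℝ] E →L[ℝ] ℝ) (Φ : 𝓢(E, ℂ)) : ContDiff ℝ ∞ (atomFun B Φ) := by
  have h1 : ContDiff ℝ ∞ (fun q : (E × E) × E => Φ (q.2 - q.1.1)) :=
    (Φ.smooth ⊤).comp (by fun_prop)
  exact h1.mul (hasTemperateGrowth_phase B).1

lemma one_add_pow_mul_norm_iteratedFDeriv_le (Φ : 𝓢(E, ℂ)) (k n : ℕ) :
    ∃ C : ℝ, 0 ≤ C ∧ ∀ i ≤ n, ∀ x, (1 + ‖x‖) ^ k * ‖iteratedFDeriv ℝ i Φ x‖ ≤ C := by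
  refine ⟨2 ^ k * (Finset.Iic (k, n)).sup (fun m => SchwartzMap.seminorm ℝ m.1 m.2) Φ,
    by positivity, fun i hi x => ?_⟩
  exact SchwartzMap.one_add_le_sup_seminorm_apply (𝕜 := ℝ) (m := (k, n)) le_rfl hi Φ x

lemma one_add_norm_le_mul {E : Type*} [NormedAddCommGroup E] (x y : E) :
    1 + ‖y‖ ≤ (1 + ‖y - x‖) * (1 + ‖x‖) := by
  have h := norm_le_norm_add_norm_sub' y x
  nlinarith [norm_nonneg x, norm_nonneg (y - x), mul_nonneg (norm_nonneg (y - x)) (norm_nonneg x)]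

lemma atomFun_bound (B : E →L[ℝ] E →L[ℝ] ℝ) (Φ : 𝓢(E, ℂ)) (k n : ℕ) :
    ∃ (C : ℝ) (N : ℕ), 0 ≤ C ∧ ∀ w y, (1 + ‖y‖) ^ k * ‖iteratedFDeriv ℝ n (atomFun B Φ) (w, y)‖ ≤
      C * (1 + ‖w‖) ^ N := by
  obtain ⟨m, C1, hC1, h1⟩ := (hasTemperateGrowth_phase B).norm_iteratedFDeriv_le_uniform n
  obtain ⟨C2, hC2, h2⟩ := one_add_pow_mul_norm_iteratedFDeriv_le Φ (k + m) n
  set L : (E × E) × E →L[ℝ] E := ContinuousLinearMap.snd ℝ (E × E) E -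
    (ContinuousLinearMap.fst ℝ E E).comp (ContinuousLinearMap.fst ℝ (E × E) E) with hL
  have hΦL : ∀ i, ∀ q, ‖iteratedFDeriv ℝ i (fun q : (E × E) × E => Φ (q.2 - q.1.1)) q‖ ≤
      (1 + ‖L‖) ^ i * ‖iteratedFDeriv ℝ i Φ (q.2 - q.1.1)‖ := by
    intro i q
    have := L.iteratedFDeriv_comp_right (Φ.smooth ⊤) q (i := i) (mod_cast le_top)
    have e : (fun q : (E × E) × E => Φ (q.2 - q.1.1)) = Φ ∘ L := by
      funext q; simp [hL]
    rw [e, this]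
    refine (ContinuousMultilinearMap.norm_compContinuousLinearMap_le _ _).trans ?_
    have e2 : L q = q.2 - q.1.1 := by simp [hL]
    rw [e2, mul_comm]
    simp only [Finset.prod_const, Finset.card_univ, Fintype.card_fin]
    gcongr
    linarith [norm_nonneg L]
  refine ⟨∑ i ∈ Finset.range (n + 1), (n.choose i : ℝ) * ((1 + ‖L‖) ^ i * C2) * C1,
    k + m + m, by positivity, fun w y => ?_⟩
  have hmul := norm_iteratedFDeriv_mul_le (𝕜 := ℝ) (N := ∞)
    (f := fun q : (E × E) × E => Φ (q.2 - q.1.1))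
    ((Φ.smooth ⊤).comp (by fun_prop)) (hasTemperateGrowth_phase B).1 (w, y) (n := n)
    (mod_cast le_top)
  have hx : ‖w.1‖ ≤ ‖w‖ := norm_fst_le w
  have hy1 : 1 + ‖y‖ ≤ (1 + ‖y - w.1‖) * (1 + ‖w‖) := by
    refine (one_add_norm_le_mul w.1 y).trans ?_
    gcongr
  have hq : 1 + ‖(w, y)‖ ≤ (1 + ‖w‖) * (1 + ‖y‖) := by
    have : ‖(w, y)‖ ≤ ‖w‖ + ‖y‖ := by
      rw [Prod.norm_def]; apply max_le <;> simp
    nlinarith [norm_nonneg w, norm_nonneg y, mul_nonneg (norm_nonneg w) (norm_nonneg y)]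
  calc (1 + ‖y‖) ^ k * ‖iteratedFDeriv ℝ n (atomFun B Φ) (w, y)‖
      ≤ (1 + ‖y‖) ^ k * ∑ i ∈ Finset.range (n + 1), (n.choose i : ℝ) *
        ((1 + ‖L‖) ^ i * ‖iteratedFDeriv ℝ i Φ (y - w.1)‖) *
        (C1 * ((1 + ‖w‖) * (1 + ‖y‖)) ^ m) := by
        gcongr
        refine hmul.trans (Finset.sum_le_sum fun i hi => ?_)
        gcongr
        · exact hΦL i (w, y)
        · refine (h1 _ (Nat.sub_le _ _) (w, y)).trans ?_
          gcongr
    _ = ∑ i ∈ Finset.range (n + 1), (n.choose i : ℝ) *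
        ((1 + ‖L‖) ^ i * ((1 + ‖y‖) ^ (k + m) * ‖iteratedFDeriv ℝ i Φ (y - w.1)‖)) *
        C1 * (1 + ‖w‖) ^ m := by
        rw [Finset.mul_sum]
        refine Finset.sum_congr rfl fun i _ => ?_
        rw [mul_pow, pow_add]; ring
    _ ≤ ∑ i ∈ Finset.range (n + 1), (n.choose i : ℝ) *
        ((1 + ‖L‖) ^ i * ((1 + ‖w‖) ^ (k + m) * C2)) * C1 * (1 + ‖w‖) ^ m := by
        refine Finset.sum_le_sum fun i hi => ?_
        suffices H : (1 + ‖y‖) ^ (k + m) * ‖iteratedFDeriv ℝ i Φ (y - w.1)‖ ≤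
            (1 + ‖w‖) ^ (k + m) * C2 by gcongr
        calc (1 + ‖y‖) ^ (k + m) * ‖iteratedFDeriv ℝ i Φ (y - w.1)‖
            ≤ ((1 + ‖y - w.1‖) * (1 + ‖w‖)) ^ (k + m) * ‖iteratedFDeriv ℝ i Φ (y - w.1)‖ := by
              gcongr
          _ = (1 + ‖w‖) ^ (k + m) *
              ((1 + ‖y - w.1‖) ^ (k + m) * ‖iteratedFDeriv ℝ i Φ (y - w.1)‖) := by
              rw [mul_pow]; ring
          _ ≤ _ := by
              gcongr
              exact h2 i (Nat.lt_succ_iff.1 (Finset.mem_range.1 hi)) _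
    _ = _ := by
        rw [Finset.sum_mul]
        refine Finset.sum_congr rfl fun i _ => ?_
        rw [pow_add (1 + ‖w‖) (k + m) m]; ring

lemma iteratedFDeriv_slice {W : Type*} [NormedAddCommGroup W] [NormedSpace ℝ W] {A : W × E → ℂ}
    (hA : ContDiff ℝ ∞ A) (n : ℕ) (w : W) (y : E) :
    iteratedFDeriv ℝ n (fun y => A (w, y)) y =
      (iteratedFDeriv ℝ n A (w, y)).compContinuousLinearMap
        (fun _ => ContinuousLinearMap.inr ℝ W E) := by
  have e : (fun y => A (w, y)) = (fun q => A (q + (w, 0))) ∘ ContinuousLinearMap.inr ℝ W E := by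
    funext y; simp
  have hA' : ContDiff ℝ ∞ fun q => A (q + (w, 0)) := hA.comp (by fun_prop)
  rw [e, (ContinuousLinearMap.inr ℝ W E).iteratedFDeriv_comp_right hA' y (mod_cast le_top),
    iteratedFDeriv_comp_add_right]
  simp

lemma norm_compContinuousLinearMap_inr_le {W : Type*} [NormedAddCommGroup W] [NormedSpace ℝ W]
    {n : ℕ} (M : ContinuousMultilinearMap ℝ (fun _ : Fin n => W × E) ℂ) :
    ‖M.compContinuousLinearMap (fun _ => ContinuousLinearMap.inr ℝ W E)‖ ≤ ‖M‖ := by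
  refine (ContinuousMultilinearMap.norm_compContinuousLinearMap_le _ _).trans ?_
  apply mul_le_of_le_one_right (norm_nonneg _)
  exact Finset.prod_le_one (fun _ _ => norm_nonneg _)
    fun _ _ => ContinuousLinearMap.norm_inr_le_one ℝ W E

/-- The time-frequency shift `y ↦ Φ (y - w.1) exp (-i B(y, w.2))` of a Schwartz function. -/
def atom (B : E →L[ℝ] E →L[ℝ] ℝ) (Φ : 𝓢(E, ℂ)) (w : E × E) : 𝓢(E, ℂ) where
  toFun y := atomFun B Φ (w, y)
  smooth' := (contDiff_atomFun B Φ).comp (by fun_prop)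
  decay' k n := by
    obtain ⟨C, N, hC, h⟩ := atomFun_bound B Φ k n
    refine ⟨C * (1 + ‖w‖) ^ N, fun y => le_trans ?_ (h w y)⟩
    rw [iteratedFDeriv_slice (contDiff_atomFun B Φ)]
    gcongr
    · linarith
    · exact norm_compContinuousLinearMap_inr_le _

lemma seminorm_atom_le (B : E →L[ℝ] E →L[ℝ] ℝ) (Φ : 𝓢(E, ℂ)) (k n : ℕ) :
    ∃ (C : ℝ) (N : ℕ), 0 ≤ C ∧ ∀ w, SchwartzMap.seminorm ℂ k n (atom B Φ w) ≤
      C * (1 + ‖w‖) ^ N := by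
  obtain ⟨C, N, hC, h⟩ := atomFun_bound B Φ k n
  refine ⟨C, N, hC, fun w => SchwartzMap.seminorm_le_bound ℂ k n _ (by positivity) fun y =>
    le_trans ?_ (h w y)⟩
  change _ * ‖iteratedFDeriv ℝ n (fun y => atomFun B Φ (w, y)) y‖ ≤ _
  rw [iteratedFDeriv_slice (contDiff_atomFun B Φ)]
  gcongr
  · linarith
  · exact norm_compContinuousLinearMap_inr_le _

lemma seminorm_atom_sub_le (B : E →L[ℝ] E →L[ℝ] ℝ) (Φ : 𝓢(E, ℂ)) (k n : ℕ) (R : ℝ) :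
    ∃ C : ℝ, 0 ≤ C ∧ ∀ w w', ‖w‖ ≤ R → ‖w'‖ ≤ R →
      SchwartzMap.seminorm ℂ k n (atom B Φ w' - atom B Φ w) ≤ C * ‖w' - w‖ := by
  obtain ⟨C, N, hC, h⟩ := atomFun_bound B Φ k (n + 1)
  refine ⟨C * (1 + |R|) ^ N, by positivity, fun w w' hw hw' =>
    SchwartzMap.seminorm_le_bound ℂ k n _ (by positivity) fun y => ?_⟩
  have hA := contDiff_atomFun B Φ
  have e1 : iteratedFDeriv ℝ n (atom B Φ w' - atom B Φ w) y =
      (iteratedFDeriv ℝ n (atomFun B Φ) (w', y) - iteratedFDeriv ℝ n (atomFun B Φ) (w, y)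
        ).compContinuousLinearMap (fun _ => ContinuousLinearMap.inr ℝ (E × E) E) := by
    have e2 : (⇑(atom B Φ w' - atom B Φ w) : E → ℂ) = ⇑(atom B Φ w') - ⇑(atom B Φ w) := rfl
    have e3 : ∀ w, iteratedFDeriv ℝ n (atom B Φ w) y = _ := fun w =>
      iteratedFDeriv_slice hA n w y
    rw [e2, iteratedFDeriv_sub_apply ((atom B Φ w').smooth n).contDiffAt
      ((atom B Φ w).smooth n).contDiffAt, e3, e3]
    rfl
  set D := fun v : E × E => iteratedFDeriv ℝ n (atomFun B Φ) (v, y) with hD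
  have hDd : Differentiable ℝ D := by
    have : Differentiable ℝ (iteratedFDeriv ℝ n (atomFun B Φ)) :=
      hA.differentiable_iteratedFDeriv (mod_cast WithTop.coe_lt_top _)
    exact this.comp (by fun_prop)
  have hDb : ∀ v ∈ Metric.closedBall (0 : E × E) R,
      ‖fderiv ℝ D v‖ ≤ C * (1 + |R|) ^ N / (1 + ‖y‖) ^ k := by
    intro v hv
    rw [mem_closedBall_zero_iff] at hv
    have h1 : fderiv ℝ D v = (fderiv ℝ (iteratedFDeriv ℝ n (atomFun B Φ)) (v, y)).comp
        (ContinuousLinearMap.inl ℝ (E × E) E) := by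
      have hd : DifferentiableAt ℝ (iteratedFDeriv ℝ n (atomFun B Φ)) (v, y) :=
        (hA.differentiable_iteratedFDeriv (mod_cast WithTop.coe_lt_top _)) _
      exact (hd.hasFDerivAt.comp v (hasFDerivAt_prodMk_left v y)).fderiv
    rw [h1, le_div_iff₀ (by positivity)]
    calc _ ≤ ‖fderiv ℝ (iteratedFDeriv ℝ n (atomFun B Φ)) (v, y)‖ * 1 * (1 + ‖y‖) ^ k := by
          gcongr
          refine (ContinuousLinearMap.opNorm_comp_le _ _).trans ?_
          gcongr
          exact ContinuousLinearMap.norm_inl_le_one ℝ (E × E) E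
      _ = (1 + ‖y‖) ^ k * ‖iteratedFDeriv ℝ (n + 1) (atomFun B Φ) (v, y)‖ := by
          rw [norm_fderiv_iteratedFDeriv]; ring
      _ ≤ C * (1 + ‖v‖) ^ N := h v y
      _ ≤ _ := by
          gcongr
          exact hv.trans (le_abs_self R)
  have hmv := (convex_closedBall (0 : E × E) R).norm_image_sub_le_of_norm_fderiv_le
    (fun v _ => hDd v) hDb (mem_closedBall_zero_iff.2 hw) (mem_closedBall_zero_iff.2 hw')
  rw [e1]
  calc _ ≤ (1 + ‖y‖) ^ k * ‖D w' - D w‖ := by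
        gcongr
        · linarith
        · exact norm_compContinuousLinearMap_inr_le _
    _ ≤ (1 + ‖y‖) ^ k * (C * (1 + |R|) ^ N / (1 + ‖y‖) ^ k * ‖w' - w‖) := by gcongr
    _ = _ := by field_simp

lemma continuous_atom (B : E →L[ℝ] E →L[ℝ] ℝ) (Φ : 𝓢(E, ℂ)) : Continuous (atom B Φ) := by
  rw [continuous_iff_continuousAt]
  intro w
  rw [ContinuousAt, (schwartz_withSeminorms ℂ E ℂ).tendsto_nhds _ _]
  rintro ⟨k, n⟩ ε hε
  obtain ⟨C, hC, h⟩ := seminorm_atom_sub_le B Φ k n (‖w‖ + 1)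
  filter_upwards [Metric.ball_mem_nhds w one_pos,
    Metric.ball_mem_nhds w (show 0 < ε / (C + 1) by positivity)] with v hv hv'
  rw [mem_ball_iff_norm] at hv hv'
  have h1 : ‖v‖ ≤ ‖w‖ + 1 := by
    have := norm_le_norm_add_norm_sub' v w
    linarith
  calc _ ≤ C * ‖v - w‖ := h w v (by linarith) h1
    _ ≤ (C + 1) * ‖v - w‖ := by gcongr; linarith
    _ < (C + 1) * (ε / (C + 1)) := by gcongr
    _ = ε := by field_simp

lemma sup_seminorm_atom_le (B : E →L[ℝ] E →L[ℝ] ℝ) (Φ : 𝓢(E, ℂ)) (S : Finset (ℕ × ℕ)) :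
    ∃ (C : ℝ) (N : ℕ), 0 ≤ C ∧ ∀ w, (S.sup (schwartzSeminormFamily ℂ E ℂ)) (atom B Φ w) ≤
      C * (1 + ‖w‖) ^ N := by
  induction S using Finset.induction_on with
  | empty => exact ⟨0, 0, le_rfl, fun w => by simp⟩
  | insert a S _ ih =>
    obtain ⟨C, N, hC, h⟩ := ih
    obtain ⟨C', N', hC', h'⟩ := seminorm_atom_le B Φ a.1 a.2
    refine ⟨C + C', N + N', by positivity, fun w => ?_⟩
    have h1 : 1 ≤ 1 + ‖w‖ := by linarith [norm_nonneg w]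
    rw [Finset.sup_insert]
    apply max_le
    · calc _ ≤ C' * (1 + ‖w‖) ^ N' := h' w
        _ ≤ _ := by
          gcongr
          · linarith
          · omega
    · calc _ ≤ C * (1 + ‖w‖) ^ N := h w
        _ ≤ _ := by
          gcongr
          · linarith
          · omega

lemma exists_bound_of_clm (u : 𝓢(E, ℂ) →L[ℂ] ℂ) :
    ∃ (S : Finset (ℕ × ℕ)) (C : ℝ), 0 ≤ C ∧
      ∀ f, ‖u f‖ ≤ C * (S.sup (schwartzSeminormFamily ℂ E ℂ)) f := by
  obtain ⟨S, C, -, h⟩ := Seminorm.bound_of_continuous (schwartz_withSeminorms ℂ E ℂ)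
    ((normSeminorm ℂ ℂ).comp u.toLinearMap) (continuous_norm.comp u.continuous)
  exact ⟨S, C, C.2, fun f => h f⟩

lemma norm_clm_atom_le (B : E →L[ℝ] E →L[ℝ] ℝ) (u : 𝓢(E, ℂ) →L[ℂ] ℂ) (Φ : 𝓢(E, ℂ)) :
    ∃ (C : ℝ) (N : ℕ), 0 ≤ C ∧ ∀ w, ‖u (atom B Φ w)‖ ≤ C * (1 + ‖w‖) ^ N := by
  obtain ⟨S, C, hC, h⟩ := exists_bound_of_clm u
  obtain ⟨C', N, hC', h'⟩ := sup_seminorm_atom_le B Φ S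
  refine ⟨C * C', N, by positivity, fun w => (h _).trans ?_⟩
  rw [mul_assoc]
  gcongr
  exact h' w

end Atom

/-! ### Weak integrals of time-frequency shifts -/

section Simple
variable {W : Type*} [NormedAddCommGroup W] [NormedSpace ℝ W] [FiniteDimensional ℝ W]
  [MeasurableSpace W] [BorelSpace W]

/-- Simple functions converging pointwise to the identity. -/
def approxId (W : Type*) [NormedAddCommGroup W] [NormedSpace ℝ W] [FiniteDimensional ℝ W]
    [MeasurableSpace W] [BorelSpace W] (n : ℕ) : SimpleFunc W W :=
  have : ProperSpace W := FiniteDimensional.proper ℝ W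
  SimpleFunc.approxOn (id : W → W) measurable_id Set.univ 0 (Set.mem_univ _) n

lemma norm_approxId_le (n : ℕ) (w : W) : ‖approxId W n w‖ ≤ 2 * ‖w‖ := by
  have : ProperSpace W := FiniteDimensional.proper ℝ W
  have := SimpleFunc.norm_approxOn_zero_le (measurable_id (α := W)) (Set.mem_univ (0 : W)) w n
  simp only [id] at this
  rw [two_mul]
  exact this

lemma tendsto_approxId (w : W) : Tendsto (fun n => approxId W n w) atTop (𝓝 w) := by
  have : ProperSpace W := FiniteDimensional.proper ℝ W
  exact SimpleFunc.tendsto_approxOn (measurable_id (α := W)) (Set.mem_univ (0 : W))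
    (x := w) (by simp)

variable {V : Type*} [NormedAddCommGroup V] [NormedSpace ℂ V] [CompleteSpace V]

omit [NormedAddCommGroup W] [NormedSpace ℝ W] [FiniteDimensional ℝ W] [BorelSpace W] in
lemma integral_smul_simpleFunc (μ : Measure W) {a : W → ℂ} (ha : Integrable a μ)
    (S : SimpleFunc W W) (H : W → V) :
    ∫ w, a w • H (S w) ∂μ = ∑ v ∈ S.range, (∫ w in S ⁻¹' {v}, a w ∂μ) • H v := by
  have h1 : ∀ w, a w • H (S w) = ∑ v ∈ S.range, (S ⁻¹' {v}).indicator a w • H v := by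
    intro w
    rw [Finset.sum_eq_single (S w)]
    · simp
    · intro v _ hv
      rw [Set.indicator_of_notMem (by simpa using hv.symm), zero_smul]
    · intro h
      exact absurd (SimpleFunc.mem_range_self S w) h
  simp_rw [h1]
  rw [integral_finsetSum]
  · refine Finset.sum_congr rfl fun v _ => ?_
    rw [integral_smul_const, integral_indicator (S.measurableSet_preimage _)]
  · intro v _
    exact (ha.indicator (S.measurableSet_preimage _)).smul_const _

lemma tendsto_integral_approxId {𝕜 : Type*} [RCLike 𝕜] (μ : Measure W) {a : W → 𝕜}
    (ham : AEStronglyMeasurable a μ) {N : ℕ} (ha : Integrable (fun w => (1 + ‖w‖) ^ N * ‖a w‖) μ)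
    {H : W × W → 𝕜} (hH : Continuous H) {C : ℝ} (hC : 0 ≤ C)
    (hHb : ∀ v w, ‖H (v, w)‖ ≤ C * ((1 + ‖v‖) ^ N + (1 + ‖w‖) ^ N)) :
    Tendsto (fun n => ∫ w, a w * H (approxId W n w, w) ∂μ) atTop (𝓝 (∫ w, a w * H (w, w) ∂μ)) := by
  have : ProperSpace W := FiniteDimensional.proper ℝ W
  refine tendsto_integral_of_dominated_convergence
    (fun w => C * (2 ^ N + 1) * ((1 + ‖w‖) ^ N * ‖a w‖)) (fun n => ?_) (ha.const_mul _)
    (fun n => Eventually.of_forall fun w => ?_) (Eventually.of_forall fun w => ?_)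
  · refine ham.mul (Measurable.aestronglyMeasurable ?_)
    exact hH.measurable.comp ((approxId W n).measurable.prodMk measurable_id)
  · rw [norm_mul]
    have h1 := norm_approxId_le n w
    calc ‖a w‖ * ‖H (approxId W n w, w)‖
        ≤ ‖a w‖ * (C * ((1 + ‖approxId W n w‖) ^ N + (1 + ‖w‖) ^ N)) := by gcongr; exact hHb _ _
      _ ≤ ‖a w‖ * (C * ((2 * (1 + ‖w‖)) ^ N + (1 + ‖w‖) ^ N)) := by gcongr; linarith
      _ = _ := by rw [mul_pow]; ring
  · refine Tendsto.const_mul _ ((hH.tendsto (w, w)).comp ?_)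
    exact (tendsto_approxId w).prodMk_nhds tendsto_const_nhds

omit [NormedSpace ℝ W] [FiniteDimensional ℝ W] [BorelSpace W] in
lemma integrable_of_one_add_pow_mul {a : W → ℂ} {μ : Measure W}
    (ham : AEStronglyMeasurable a μ) {N : ℕ}
    (ha : Integrable (fun w => (1 + ‖w‖) ^ N * ‖a w‖) μ) : Integrable a μ :=
  ha.mono' ham (Eventually.of_forall fun w => le_mul_of_one_le_left (norm_nonneg _)
    (one_le_pow₀ (by linarith [norm_nonneg w])))

end Simple

section WeakIntegral
variable {E : Type*} [NormedAddCommGroup E] [NormedSpace ℝ E] [FiniteDimensional ℝ E]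
  [MeasurableSpace E] [BorelSpace E]

omit [FiniteDimensional ℝ E] [MeasurableSpace E] [BorelSpace E] in
lemma continuous_iteratedFDeriv_atom (B : E →L[ℝ] E →L[ℝ] ℝ) (Φ : 𝓢(E, ℂ)) (n : ℕ) :
    Continuous fun q : (E × E) × E => iteratedFDeriv ℝ n (atom B Φ q.1) q.2 := by
  have h : (fun q : (E × E) × E => iteratedFDeriv ℝ n (atom B Φ q.1) q.2) = fun q =>
      (iteratedFDeriv ℝ n (atomFun B Φ) q).compContinuousLinearMap
        (fun _ : Fin n => ContinuousLinearMap.inr ℝ (E × E) E) := by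
    funext q
    exact iteratedFDeriv_slice (contDiff_atomFun B Φ) n q.1 q.2
  rw [h]
  exact (ContinuousMultilinearMap.compContinuousLinearMapL (𝕜 := ℝ)
    (fun _ : Fin n => ContinuousLinearMap.inr ℝ (E × E) E)).continuous.comp
    ((contDiff_atomFun B Φ).continuous_iteratedFDeriv (mod_cast le_top))

/-- Differentiation under the integral sign of a superposition with integrable density. -/
lemma fderiv_integral_smul_apply {V : Type*} [NormedAddCommGroup V] [NormedSpace ℝ V]
    [NormedSpace ℂ V] [SMulCommClass ℝ ℂ V] [CompleteSpace V] (μ : Measure (E × E))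
    {a : E × E → ℂ} (ham : AEStronglyMeasurable a μ) {H : E × E → E → V}
    (hdiff : ∀ w, Differentiable ℝ (H w)) (hH : ∀ y, Continuous fun w => H w y)
    (hH' : ∀ y, Continuous fun w => fderiv ℝ (H w) y) {ρ : E × E → ℝ}
    (hρ : Integrable (fun w => ρ w * ‖a w‖) μ) (hInt : ∀ y, Integrable (fun w => a w • H w y) μ)
    (hb : ∀ w y, ‖fderiv ℝ (H w) y‖ ≤ ρ w) (y v : E) :
    fderiv ℝ (fun y => ∫ w, a w • H w y ∂μ) y v = ∫ w, a w • fderiv ℝ (H w) y v ∂μ := by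
  have : ProperSpace E := FiniteDimensional.proper ℝ E
  have hmeas' : ∀ y, AEStronglyMeasurable (fun w => a w • fderiv ℝ (H w) y) μ := fun y =>
    ham.smul (hH' y).aestronglyMeasurable
  have hb' : ∀ w y, ‖a w • fderiv ℝ (H w) y‖ ≤ ρ w * ‖a w‖ := by
    intro w y
    rw [norm_smul, mul_comm]
    exact mul_le_mul_of_nonneg_right (hb w y) (norm_nonneg _)
  have hInt' : Integrable (fun w => a w • fderiv ℝ (H w) y) μ :=
    hρ.mono' (hmeas' y) (Eventually.of_forall fun w => hb' w y)
  have hder : HasFDerivAt (fun y => ∫ w, a w • H w y ∂μ) (∫ w, a w • fderiv ℝ (H w) y ∂μ) y := by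
    refine hasFDerivAt_integral_of_dominated_of_fderiv_le (s := Set.univ) (𝕜 := ℝ)
      (F' := fun y w => a w • fderiv ℝ (H w) y)
      (bound := fun w => ρ w * ‖a w‖) univ_mem
      (Eventually.of_forall fun y => ham.smul (hH y).aestronglyMeasurable) (hInt y) (hmeas' y)
      (Eventually.of_forall fun w y _ => hb' w y) hρ
      (Eventually.of_forall fun w y _ => ?_)
    exact (hdiff w y).hasFDerivAt.const_smul (a w)
  rw [hder.fderiv, ContinuousLinearMap.integral_apply hInt']
  rfl

omit [FiniteDimensional ℝ E] [MeasurableSpace E] [BorelSpace E] in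
/-- Partial sums are differentiated termwise. -/
lemma iteratedFDeriv_sum_smul {ι : Type*} (t : Finset ι) (c : ι → ℂ) (g : ι → 𝓢(E, ℂ)) (l : ℕ)
    (y : E) : iteratedFDeriv ℝ l (⇑(∑ v ∈ t, c v • g v)) y =
      ∑ v ∈ t, c v • iteratedFDeriv ℝ l (g v) y := by
  classical
  have hsm : ∀ g : 𝓢(E, ℂ), ContDiffAt ℝ l g y := fun g => (g.smooth l).contDiffAt
  induction t using Finset.induction_on with
  | empty => simp [Pi.zero_def]
  | insert v t hv ih =>
    rw [Finset.sum_insert hv, Finset.sum_insert hv, ← ih]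
    refine (iteratedFDeriv_add_apply (hsm (c v • g v)) (hsm _)).trans ?_
    congr 1
    exact iteratedFDeriv_const_smul_apply (hsm _)

lemma iteratedFDeriv_integral_atom (B : E →L[ℝ] E →L[ℝ] ℝ) (Φ : 𝓢(E, ℂ)) (μ : Measure (E × E))
    {a : E × E → ℂ} (ham : AEStronglyMeasurable a μ)
    (ha : ∀ N : ℕ, Integrable (fun w => (1 + ‖w‖) ^ N * ‖a w‖) μ) (n : ℕ) :
    iteratedFDeriv ℝ n (fun y => ∫ w, a w * atom B Φ w y ∂μ) =
      fun y => ∫ w, a w • iteratedFDeriv ℝ n (atom B Φ w) y ∂μ := by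
  have : ProperSpace E := FiniteDimensional.proper ℝ E
  have hbd : ∀ n : ℕ, ∃ (C : ℝ) (N : ℕ), 0 ≤ C ∧ ∀ w y,
      ‖iteratedFDeriv ℝ n (atom B Φ w) y‖ ≤ C * (1 + ‖w‖) ^ N := by
    intro n
    obtain ⟨C, N, hC, h⟩ := seminorm_atom_le B Φ 0 n
    refine ⟨C, N, hC, fun w y => le_trans ?_ (h w)⟩
    simpa using SchwartzMap.le_seminorm ℂ 0 n (atom B Φ w) y
  have hmeas : ∀ (n : ℕ) (y : E),
      AEStronglyMeasurable (fun w => a w • iteratedFDeriv ℝ n (atom B Φ w) y) μ := by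
    intro n y
    refine ham.smul (Continuous.aestronglyMeasurable ?_)
    exact (continuous_iteratedFDeriv_atom B Φ n).comp (f := fun w => (w, y)) (by fun_prop)
  have hle : ∀ (n : ℕ) {C : ℝ} {N : ℕ}, (∀ w y, ‖iteratedFDeriv ℝ n (atom B Φ w) y‖ ≤
      C * (1 + ‖w‖) ^ N) → ∀ w y, ‖a w • iteratedFDeriv ℝ n (atom B Φ w) y‖ ≤
        C * ((1 + ‖w‖) ^ N * ‖a w‖) := by
    intro n C N h w y
    rw [norm_smul]
    calc _ ≤ ‖a w‖ * (C * (1 + ‖w‖) ^ N) := by gcongr; exact h w y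
      _ = _ := by ring
  have hInt : ∀ (n : ℕ) (y : E),
      Integrable (fun w => a w • iteratedFDeriv ℝ n (atom B Φ w) y) μ := by
    intro n y
    obtain ⟨C, N, hC, h⟩ := hbd n
    exact ((ha N).const_mul C).mono' (hmeas n y) (Eventually.of_forall fun w => hle n h w y)
  induction n with
  | zero =>
    funext y
    ext m
    rw [iteratedFDeriv_zero_apply, ContinuousMultilinearMap.integral_apply (hInt 0 y)]
    rfl
  | succ n ih =>
    funext y
    obtain ⟨C, N, hC, h⟩ := hbd (n + 1)
    have hc : ∀ y, Continuous fun w => fderiv ℝ (iteratedFDeriv ℝ n (atom B Φ w)) y := by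
      intro y
      have e : ∀ w, fderiv ℝ (iteratedFDeriv ℝ n (atom B Φ w)) y =
          continuousMultilinearCurryLeftEquiv ℝ (fun _ : Fin (n + 1) => E) ℂ
            (iteratedFDeriv ℝ (n + 1) (atom B Φ w) y) := by
        intro w
        rw [iteratedFDeriv_succ_eq_comp_left]
        simp
      simp_rw [e]
      exact (LinearIsometryEquiv.continuous _).comp
        ((continuous_iteratedFDeriv_atom B Φ (n + 1)).comp (f := fun w => (w, y)) (by fun_prop))
    ext m
    rw [iteratedFDeriv_succ_apply_left, ih, fderiv_integral_smul_apply μ ham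
      (fun w => ((atom B Φ w).smooth ⊤).differentiable_iteratedFDeriv
        (mod_cast WithTop.coe_lt_top _))
      (fun y => (continuous_iteratedFDeriv_atom B Φ n).comp (f := fun w => (w, y)) (by fun_prop))
      hc (ρ := fun w => C * (1 + ‖w‖) ^ N) (by simpa only [mul_assoc] using (ha N).const_mul C)
      (fun y => hInt n y) (fun w y => by rw [norm_fderiv_iteratedFDeriv]; exact h w y),
      ContinuousMultilinearMap.integral_apply (hInt (n + 1) y),
      ContinuousMultilinearMap.integral_apply]
    · rfl
    · refine ((ha N).const_mul (C * ‖m 0‖)).mono' (ham.smul (Continuous.aestronglyMeasurable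
        ((hc y).clm_apply continuous_const))) (Eventually.of_forall fun w => ?_)
      rw [norm_smul]
      have h1 := ContinuousLinearMap.le_opNorm (fderiv ℝ (iteratedFDeriv ℝ n (atom B Φ w)) y) (m 0)
      rw [norm_fderiv_iteratedFDeriv] at h1
      calc _ ≤ ‖a w‖ * (C * (1 + ‖w‖) ^ N * ‖m 0‖) := by
            refine mul_le_mul_of_nonneg_left (h1.trans ?_) (norm_nonneg _)
            exact mul_le_mul_of_nonneg_right (h w y) (norm_nonneg _)
        _ = _ := by ring

/-- If `f` is a superposition of time-frequency shifts with rapidly decreasing density, then a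
tempered distribution may be applied under the integral sign. -/
theorem clm_apply_eq_integral_atom (B : E →L[ℝ] E →L[ℝ] ℝ) (Φ : 𝓢(E, ℂ)) (μ : Measure (E × E))
    (u : 𝓢(E, ℂ) →L[ℂ] ℂ) {a : E × E → ℂ} (ham : AEStronglyMeasurable a μ)
    (ha : ∀ N : ℕ, Integrable (fun w => (1 + ‖w‖) ^ N * ‖a w‖) μ) (f : 𝓢(E, ℂ))
    (hf : ∀ y, ∫ w, a w * atom B Φ w y ∂μ = f y) :
    ∫ w, a w * u (atom B Φ w) ∂μ = u f := by
  have : ProperSpace E := FiniteDimensional.proper ℝ E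
  have hai : Integrable a μ := integrable_of_one_add_pow_mul ham (ha 0)
  set S := fun n => approxId (E × E) n with hS
  set F : ℕ → 𝓢(E, ℂ) := fun n => ∑ v ∈ (S n).range, (∫ w in (S n) ⁻¹' {v}, a w ∂μ) • atom B Φ v
    with hF
  have hlim1 : Tendsto (fun n => u (F n)) atTop (𝓝 (∫ w, a w * u (atom B Φ w) ∂μ)) := by
    obtain ⟨C, N, hC, h⟩ := norm_clm_atom_le B u Φ
    have := tendsto_integral_approxId μ ham (ha N) (H := fun q => u (atom B Φ q.1))
      (u.continuous.comp ((continuous_atom B Φ).comp continuous_fst)) hC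
      (fun v w => (h v).trans (by gcongr; exact le_add_of_nonneg_right (by positivity)))
    refine this.congr fun n => ?_
    have e := integral_smul_simpleFunc μ hai (S n) (fun v => u (atom B Φ v))
    simp only [smul_eq_mul] at e
    rw [hF]
    simp only [map_sum, map_smul, smul_eq_mul]
    exact e
  have hlim2 : Tendsto F atTop (𝓝 f) := by
    refine ((schwartz_withSeminorms ℂ E ℂ).tendsto_nhds F f).2 ?_
    rintro ⟨k, l⟩
    set p : Seminorm ℂ 𝓢(E, ℂ) := SchwartzMap.seminorm ℂ k l with hp
    have hpc : Continuous p := (schwartz_withSeminorms ℂ E ℂ).continuous_seminorm (k, l)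
    obtain ⟨C, N, hC, h⟩ := seminorm_atom_le B Φ k l
    obtain ⟨C0, N0, hC0, h0⟩ := seminorm_atom_le B Φ 0 l
    have hcont : Continuous fun q : (E × E) × (E × E) => p (atom B Φ q.1 - atom B Φ q.2) :=
      hpc.comp (((continuous_atom B Φ).comp continuous_fst).sub
        ((continuous_atom B Φ).comp continuous_snd))
    have hpb : ∀ v w, p (atom B Φ v - atom B Φ w) ≤ C * ((1 + ‖v‖) ^ N + (1 + ‖w‖) ^ N) := by
      intro v w
      rw [mul_add]
      exact (map_sub_le_add p _ _).trans (add_le_add (h v) (h w))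
    have hlim := tendsto_integral_approxId (𝕜 := ℝ) μ ham.norm
      (by simpa only [norm_norm] using ha N) hcont hC
      (fun v w => by rw [Real.norm_of_nonneg (apply_nonneg p _)]; exact hpb v w)
    simp only [sub_self, map_zero, mul_zero, integral_zero] at hlim
    have hle : ∀ n, p (F n - f) ≤ ∫ w, ‖a w‖ * p (atom B Φ (S n w) - atom B Φ w) ∂μ := by
      intro n
      refine SchwartzMap.seminorm_le_bound ℂ k l _ (integral_nonneg fun w => by positivity)
        fun y => ?_
      have hb0 : ∀ w, ‖iteratedFDeriv ℝ l (atom B Φ w) y‖ ≤ C0 * (1 + ‖w‖) ^ N0 := fun w => by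
        simpa using (SchwartzMap.le_seminorm ℂ 0 l (atom B Φ w) y).trans (h0 w)
      have i1 : iteratedFDeriv ℝ l (F n - f) y =
          ∫ w, a w • (iteratedFDeriv ℝ l (atom B Φ (S n w)) y -
            iteratedFDeriv ℝ l (atom B Φ w) y) ∂μ := by
        have hsm : ∀ g : 𝓢(E, ℂ), ContDiffAt ℝ l g y := fun g => (g.smooth l).contDiffAt
        have e1 : iteratedFDeriv ℝ l (F n - f) y =
            iteratedFDeriv ℝ l (F n) y - iteratedFDeriv ℝ l f y :=
          iteratedFDeriv_sub_apply (hsm _) (hsm _)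
        have e2 : iteratedFDeriv ℝ l (F n) y =
            ∫ w, a w • iteratedFDeriv ℝ l (atom B Φ (S n w)) y ∂μ := by
          rw [integral_smul_simpleFunc μ hai (S n)
            (fun v => iteratedFDeriv ℝ l (atom B Φ v) y)]
          exact iteratedFDeriv_sum_smul _ _ _ l y
        have e3 : iteratedFDeriv ℝ l f y = ∫ w, a w • iteratedFDeriv ℝ l (atom B Φ w) y ∂μ := by
          rw [← congrFun (iteratedFDeriv_integral_atom B Φ μ ham ha l) y, ← funext hf]
        rw [e1, e2, e3, ← integral_sub]
        · simp only [smul_sub]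
        · refine ((ha N0).const_mul (C0 * 2 ^ N0)).mono' (ham.smul
            (((continuous_iteratedFDeriv_atom B Φ l).comp (f := fun w => (w, y))
              (by fun_prop)).comp_stronglyMeasurable (S n).stronglyMeasurable).aestronglyMeasurable)
            (Eventually.of_forall fun w => ?_)
          have h1 := norm_approxId_le n w
          rw [norm_smul]
          calc _ ≤ ‖a w‖ * (C0 * (2 * (1 + ‖w‖)) ^ N0) := by
                refine mul_le_mul_of_nonneg_left ((hb0 _).trans ?_) (norm_nonneg _)
                refine mul_le_mul_of_nonneg_left ?_ hC0
                exact pow_le_pow_left₀ (by positivity) (by linarith) N0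
            _ = _ := by rw [mul_pow]; ring
        · refine ((ha N0).const_mul C0).mono' (ham.smul (Continuous.aestronglyMeasurable
            ((continuous_iteratedFDeriv_atom B Φ l).comp (f := fun w => (w, y))
              (by fun_prop)))) (Eventually.of_forall fun w => ?_)
          rw [norm_smul]
          calc _ ≤ ‖a w‖ * (C0 * (1 + ‖w‖) ^ N0) :=
                mul_le_mul_of_nonneg_left (hb0 w) (norm_nonneg _)
            _ = _ := by ring
      have hI : Integrable (fun w => ‖a w‖ * p (atom B Φ (S n w) - atom B Φ w)) μ := by
        refine ((ha N).const_mul (C * (2 ^ N + 1))).mono' ?_ (Eventually.of_forall fun w => ?_)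
        · exact ham.norm.mul (hcont.measurable.comp
            ((S n).measurable.prodMk measurable_id)).aestronglyMeasurable
        · have h1 := norm_approxId_le n w
          rw [Real.norm_of_nonneg (by positivity)]
          calc _ ≤ ‖a w‖ * (C * ((1 + ‖S n w‖) ^ N + (1 + ‖w‖) ^ N)) := by gcongr; exact hpb _ _
            _ ≤ ‖a w‖ * (C * ((2 * (1 + ‖w‖)) ^ N + (1 + ‖w‖) ^ N)) := by gcongr; linarith
            _ = _ := by rw [mul_pow]; ring
      rw [i1]
      calc ‖y‖ ^ k * ‖∫ w, a w • (iteratedFDeriv ℝ l (atom B Φ (S n w)) y -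
              iteratedFDeriv ℝ l (atom B Φ w) y) ∂μ‖
          ≤ ‖y‖ ^ k * ∫ w, ‖a w • (iteratedFDeriv ℝ l (atom B Φ (S n w)) y -
              iteratedFDeriv ℝ l (atom B Φ w) y)‖ ∂μ := by
            gcongr
            exact norm_integral_le_integral_norm _
        _ = ∫ w, ‖y‖ ^ k * ‖a w • (iteratedFDeriv ℝ l (atom B Φ (S n w)) y -
              iteratedFDeriv ℝ l (atom B Φ w) y)‖ ∂μ := (integral_const_mul _ _).symm
        _ ≤ _ := by
            refine integral_mono_of_nonneg (Eventually.of_forall fun w => by positivity) hI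
              (Eventually.of_forall fun w => ?_)
            have h1 := SchwartzMap.le_seminorm ℂ k l (atom B Φ (S n w) - atom B Φ w) y
            have h2 : iteratedFDeriv ℝ l (⇑(atom B Φ (S n w) - atom B Φ w)) y =
              iteratedFDeriv ℝ l (atom B Φ (S n w)) y - iteratedFDeriv ℝ l (atom B Φ w) y :=
              iteratedFDeriv_sub_apply (((atom B Φ (S n w)).smooth l).contDiffAt)
                (((atom B Φ w).smooth l).contDiffAt)
            rw [h2] at h1
            simp only [norm_smul]
            rw [mul_left_comm]
            exact mul_le_mul_of_nonneg_left h1 (norm_nonneg _)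
    intro ε hε
    filter_upwards [hlim.eventually_lt_const hε] with n hn
    exact (hle n).trans_lt hn
  exact tendsto_nhds_unique hlim1 ((u.continuous.tendsto f).comp hlim2)

end WeakIntegral

/-! ### Short-time Fourier transforms of Schwartz functions -/

variable {d : ℕ}

instance isAddHaarMeasure_volume_prod : (volume : Measure (Ed d × Ed d)).IsAddHaarMeasure := by
  rw [Measure.volume_eq_prod]
  infer_instance

/-- The inner product as a continuous bilinear form. -/
def bil (d : ℕ) : Ed d →L[ℝ] Ed d →L[ℝ] ℝ := innerSL ℝ

/-- The time-frequency shift `y ↦ Φ (y - x) e^{-i⟨y,ξ⟩}` at `w = (x, ξ)`. -/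
def tf (Φ : 𝓢(Ed d, ℂ)) (w : Ed d × Ed d) : 𝓢(Ed d, ℂ) := atom (bil d) Φ w

lemma tf_apply (Φ : 𝓢(Ed d, ℂ)) (w : Ed d × Ed d) (y : Ed d) :
    tf Φ w y = Φ (y - w.1) * Complex.exp (-(Complex.I * (⟪y, w.2⟫ : ℝ))) := rfl

lemma norm_exp_neg_I_mul (t : ℝ) : ‖Complex.exp (-(Complex.I * (t : ℝ)))‖ = 1 := by
  rw [← mul_neg, ← Complex.ofReal_neg, mul_comm, Complex.norm_exp_ofReal_mul_I]

/-- The tempered distribution defined by a Schwartz function. -/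
def pairCLM (f : 𝓢(Ed d, ℂ)) : TD d :=
  (SchwartzMap.integralCLM ℂ volume).comp (SchwartzMap.smulLeftCLM ℂ (f : Ed d → ℂ))

lemma pairCLM_apply (f g : 𝓢(Ed d, ℂ)) : pairCLM f g = ∫ y, f y * g y := by
  rw [pairCLM, ContinuousLinearMap.comp_apply, SchwartzMap.integralCLM_apply]
  simp only [SchwartzMap.smulLeftCLM_apply_apply f.hasTemperateGrowth, smul_eq_mul]

/-- The short-time Fourier transform of a Schwartz function, without conjugating the window. -/
def stf (χ f : 𝓢(Ed d, ℂ)) (w : Ed d × Ed d) : ℂ := pairCLM f (tf χ w)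

lemma stf_eq (χ f : 𝓢(Ed d, ℂ)) (w : Ed d × Ed d) :
    stf χ f w = ∫ y, (f y * χ (y - w.1)) * Complex.exp (-(Complex.I * (⟪y, w.2⟫ : ℝ))) := by
  simp only [stf, pairCLM_apply, tf_apply, mul_assoc]

lemma continuous_stf (χ f : 𝓢(Ed d, ℂ)) : Continuous (stf χ f) :=
  (pairCLM f).continuous.comp (continuous_atom (bil d) χ)

lemma integral_mul_exp_eq_fourier (g : Ed d → ℂ) (ξ : Ed d) :
    ∫ y, g y * Complex.exp (-(Complex.I * (⟪y, ξ⟫ : ℝ))) =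
      FourierTransform.fourier g ((2 * Real.pi)⁻¹ • ξ) := by
  rw [Real.fourier_eq']
  refine integral_congr_ae (Eventually.of_forall fun y => ?_)
  simp only [smul_eq_mul, real_inner_smul_right]
  rw [mul_comm]
  congr 2
  have : (Real.pi : ℂ) ≠ 0 := by exact_mod_cast Real.pi_ne_zero
  push_cast
  field_simp

/-- Decay of Fourier transforms in terms of integrals of derivatives. -/
lemma pow_mul_norm_integral_mul_exp_le {g : Ed d → ℂ} (hg : ContDiff ℝ ∞ g) {ρ : Ed d → ℝ}
    (hρ : Integrable ρ) (n : ℕ) (hb : ∀ i ≤ n, ∀ y, ‖iteratedFDeriv ℝ i g y‖ ≤ ρ y) (ξ : Ed d) :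
    ‖ξ‖ ^ n * ‖∫ y, g y * Complex.exp (-(Complex.I * (⟪y, ξ⟫ : ℝ)))‖ ≤
      (4 * Real.pi) ^ n * (n + 1) * ∫ y, ρ y := by
  have hgn : ContDiff ℝ (n : ℕ∞) g := hg.of_le (by exact_mod_cast le_top)
  have hInt : ∀ i ≤ n, Integrable fun y => ‖iteratedFDeriv ℝ i g y‖ := fun i hi =>
    hρ.mono' ((hg.continuous_iteratedFDeriv (by exact_mod_cast le_top)).norm.aestronglyMeasurable)
      (Eventually.of_forall fun y => by rw [norm_norm]; exact hb i hi y)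
  have h := Real.pow_mul_norm_iteratedFDeriv_fourier_le (K := 0) (N := n) hgn
    (fun k m hk hm => by
      have hk0 : k = 0 := by simpa using hk
      subst hk0
      simpa using hInt m (by exact_mod_cast hm)) (k := 0) (n := n) le_rfl le_rfl
    ((2 * Real.pi)⁻¹ • ξ)
  rw [integral_mul_exp_eq_fourier]
  have hpi := Real.pi_pos
  simp only [norm_iteratedFDeriv_zero, norm_smul, norm_inv, norm_mul, Real.norm_ofNat,
    Real.norm_of_nonneg hpi.le, mul_pow, pow_zero, one_mul, CharP.cast_eq_zero, mul_zero,
    zero_add] at h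
  have h2 : ∑ p ∈ Finset.range 1 ×ˢ Finset.range (n + 1),
      ∫ v, ‖v‖ ^ p.1 * ‖iteratedFDeriv ℝ p.2 g v‖ ≤ (n + 1) * ∫ y, ρ y := by
    calc _ ≤ ∑ p ∈ Finset.range 1 ×ˢ Finset.range (n + 1), ∫ y, ρ y := by
          refine Finset.sum_le_sum fun p hp => ?_
          simp only [Finset.mem_product, Finset.mem_range] at hp
          have hp1 : p.1 = 0 := by omega
          simp only [hp1, pow_zero, one_mul]
          exact integral_mono (hInt _ (by omega)) hρ (hb _ (by omega))
      _ = _ := by simp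
  have h3 : ‖ξ‖ ^ n * ‖FourierTransform.fourier g ((2 * Real.pi)⁻¹ • ξ)‖ = (2 * Real.pi) ^ n *
      (((2 * Real.pi)⁻¹) ^ n * ‖ξ‖ ^ n * ‖FourierTransform.fourier g ((2 * Real.pi)⁻¹ • ξ)‖) := by
    have : (2 * Real.pi) ^ n * ((2 * Real.pi)⁻¹) ^ n = 1 := by
      rw [← mul_pow, mul_inv_cancel₀ (by positivity), one_pow]
    rw [← mul_assoc, ← mul_assoc, this, one_mul]
  rw [h3]
  calc _ ≤ (2 * Real.pi) ^ n * (2 ^ n * ((n + 1) * ∫ y, ρ y)) := by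
        refine mul_le_mul_of_nonneg_left ?_ (by positivity)
        simp only [mul_inv, mul_pow, inv_pow] at h ⊢
        exact h.trans (mul_le_mul_of_nonneg_left h2 (by positivity))
    _ = _ := by rw [show (4 : ℝ) * Real.pi = 2 * Real.pi * 2 by ring, mul_pow _ (2 : ℝ)]; ring

/-- Leibniz rule with a supermultiplicative weight. -/
lemma norm_iteratedFDeriv_mul_translate_le {f χ : Ed d → ℂ} (hf : ContDiff ℝ ∞ f)
    (hχ : ContDiff ℝ ∞ χ) (x y : Ed d) {P Q : ℝ} (hP : 0 ≤ P) (hQ : 0 ≤ Q) (r : ℕ → ℝ)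
    (hr : ∀ i, 0 ≤ r i)
    (i : ℕ) (hrr : ∀ j ≤ i, r j * r (i - j) ≤ r i)
    (hfb : ∀ j ≤ i, ‖iteratedFDeriv ℝ j f y‖ ≤ P * r j)
    (hχb : ∀ j ≤ i, ‖iteratedFDeriv ℝ j χ (y - x)‖ ≤ Q * r j) :
    ‖iteratedFDeriv ℝ i (fun y => f y * χ (y - x)) y‖ ≤ 2 ^ i * (P * Q * r i) := by
  have hχ' : ContDiff ℝ ∞ fun y => χ (y - x) := hχ.comp (contDiff_id.sub contDiff_const)
  refine (norm_iteratedFDeriv_mul_le hf hχ' y (n := i) (by exact_mod_cast le_top)).trans ?_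
  have e : (2 : ℝ) ^ i = ∑ j ∈ Finset.range (i + 1), (i.choose j : ℝ) := by
    exact_mod_cast (Nat.sum_range_choose i).symm
  rw [e, Finset.sum_mul]
  refine Finset.sum_le_sum fun j hj => ?_
  have hj : j ≤ i := by simpa [Nat.lt_succ_iff] using hj
  have hχj := hχb (i - j) (Nat.sub_le _ _)
  rw [iteratedFDeriv_comp_sub]
  rw [mul_assoc]
  refine mul_le_mul_of_nonneg_left ?_ (by positivity)
  calc _ ≤ (P * r j) * (Q * r (i - j)) :=
        mul_le_mul (hfb j hj) hχj (norm_nonneg _) (mul_nonneg hP (hr j))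
    _ = P * Q * (r j * r (i - j)) := by ring
    _ ≤ _ := mul_le_mul_of_nonneg_left (hrr j hj) (mul_nonneg hP hQ)

lemma stf_decay (χ f : 𝓢(Ed d, ℂ)) (M : ℕ) :
    ∃ C, 0 ≤ C ∧ ∀ w, (1 + ‖w‖) ^ M * ‖stf χ f w‖ ≤ C := by
  set L := Module.finrank ℝ (Ed d) + 1 with hL
  obtain ⟨Cf, hCf, hf⟩ := one_add_pow_mul_norm_iteratedFDeriv_le f (M + L) M
  obtain ⟨Cχ, hCχ, hχ⟩ := one_add_pow_mul_norm_iteratedFDeriv_le χ M M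
  set I := ∫ y : Ed d, ((1 + ‖y‖) ^ L)⁻¹ with hI
  have hInn : 0 ≤ I := integral_nonneg fun y => by positivity
  have hb : ∀ x : Ed d, ∀ i ≤ M, ∀ y, ‖iteratedFDeriv ℝ i (fun y => f y * χ (y - x)) y‖ ≤
      2 ^ M * (Cf * Cχ * ((1 + ‖x‖) ^ M)⁻¹) * ((1 + ‖y‖) ^ L)⁻¹ := by
    intro x i hi y
    have h := norm_iteratedFDeriv_mul_translate_le (f.smooth ⊤) (χ.smooth ⊤) x y
      (P := Cf * ((1 + ‖y‖) ^ (M + L))⁻¹) (Q := Cχ * ((1 + ‖y - x‖) ^ M)⁻¹)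
      (by positivity) (by positivity) (fun _ => 1) (fun _ => zero_le_one) i
      (fun _ _ => by norm_num)
      (fun j hj => by
        rw [mul_one, ← div_eq_mul_inv, le_div_iff₀ (by positivity), mul_comm]
        exact hf j (hj.trans hi) y)
      (fun j hj => by
        rw [mul_one, ← div_eq_mul_inv, le_div_iff₀ (by positivity), mul_comm]
        exact hχ j (hj.trans hi) (y - x))
    refine h.trans ?_
    have h1 : (1 + ‖x‖) ^ M ≤ (1 + ‖y - x‖) ^ M * (1 + ‖y‖) ^ M := by
      rw [← mul_pow, norm_sub_rev]
      exact pow_le_pow_left₀ (by positivity) (one_add_norm_le_mul y x) M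
    have h2 : ((1 + ‖y‖) ^ (M + L))⁻¹ * ((1 + ‖y - x‖) ^ M)⁻¹ ≤
        ((1 + ‖x‖) ^ M)⁻¹ * ((1 + ‖y‖) ^ L)⁻¹ := by
      rw [← mul_inv, ← mul_inv]
      refine inv_anti₀ (by positivity) ?_
      calc _ ≤ (1 + ‖y - x‖) ^ M * (1 + ‖y‖) ^ M * (1 + ‖y‖) ^ L :=
            mul_le_mul_of_nonneg_right h1 (by positivity)
        _ = _ := by rw [pow_add]; ring
    calc _ = 2 ^ i * (Cf * Cχ * (((1 + ‖y‖) ^ (M + L))⁻¹ * ((1 + ‖y - x‖) ^ M)⁻¹)) := by ring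
      _ ≤ 2 ^ M * (Cf * Cχ * (((1 + ‖x‖) ^ M)⁻¹ * ((1 + ‖y‖) ^ L)⁻¹)) := by
          refine mul_le_mul (pow_le_pow_right₀ one_le_two hi) ?_ (by positivity) (by positivity)
          exact mul_le_mul_of_nonneg_left h2 (by positivity)
      _ = _ := by ring
  have key : ∀ n ≤ M, ∀ w : Ed d × Ed d, (1 + ‖w.1‖) ^ M * (‖w.2‖ ^ n * ‖stf χ f w‖) ≤
      (4 * Real.pi) ^ n * (n + 1) * (2 ^ M * (Cf * Cχ) * I) := by
    intro n hn w
    have hsm : ContDiff ℝ ∞ fun y => f y * χ (y - w.1) :=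
      (f.smooth ⊤).mul ((χ.smooth ⊤).comp (contDiff_id.sub contDiff_const))
    have h := pow_mul_norm_integral_mul_exp_le hsm
      (((integrable_inv_one_add_pow (V := Ed d) volume).const_mul
        (2 ^ M * (Cf * Cχ * ((1 + ‖w.1‖) ^ M)⁻¹)))) n
      (fun i hi y => hb w.1 i (hi.trans hn) y) w.2
    rw [integral_const_mul] at h
    rw [stf_eq]
    refine (mul_le_mul_of_nonneg_left h (by positivity)).trans (le_of_eq ?_)
    have : (1 + ‖w.1‖) ^ M ≠ 0 := by positivity
    rw [← hL, ← hI]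
    field_simp
  refine ⟨2 ^ M * ((4 * Real.pi) ^ 0 * ((0 : ℕ) + 1) * (2 ^ M * (Cf * Cχ) * I) +
    (4 * Real.pi) ^ M * (M + 1) * (2 ^ M * (Cf * Cχ) * I)), by positivity, fun w => ?_⟩
  have k0 := key 0 (Nat.zero_le _) w
  have k1 := key M le_rfl w
  rw [pow_zero, one_mul] at k0
  have hw : (1 + ‖w‖) ^ M ≤ (1 + ‖w.1‖) ^ M * (1 + ‖w.2‖) ^ M := by
    rw [← mul_pow]
    refine pow_le_pow_left₀ (by positivity) ?_ M
    rw [Prod.norm_def]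
    rcases max_cases ‖w.1‖ ‖w.2‖ with h | h <;>
      nlinarith [norm_nonneg w.1, norm_nonneg w.2, mul_nonneg (norm_nonneg w.1) (norm_nonneg w.2)]
  have hw2 : (1 + ‖w.2‖) ^ M ≤ 2 ^ M * (1 + ‖w.2‖ ^ M) := by
    have h3 : 1 + ‖w.2‖ ≤ 2 * max 1 ‖w.2‖ := by
      linarith [le_max_left 1 ‖w.2‖, le_max_right 1 ‖w.2‖]
    refine (pow_le_pow_left₀ (by positivity) h3 M).trans ?_
    rw [mul_pow]
    refine mul_le_mul_of_nonneg_left ?_ (by positivity)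
    rcases max_cases 1 ‖w.2‖ with h | h <;> rw [h.1]
    · rw [one_pow]; linarith [pow_nonneg (norm_nonneg w.2) M]
    · linarith
  calc (1 + ‖w‖) ^ M * ‖stf χ f w‖
      ≤ ((1 + ‖w.1‖) ^ M * (2 ^ M * (1 + ‖w.2‖ ^ M))) * ‖stf χ f w‖ := by
        refine mul_le_mul_of_nonneg_right (hw.trans ?_) (norm_nonneg _)
        exact mul_le_mul_of_nonneg_left hw2 (by positivity)
    _ = 2 ^ M * ((1 + ‖w.1‖) ^ M * ‖stf χ f w‖ +
          (1 + ‖w.1‖) ^ M * (‖w.2‖ ^ M * ‖stf χ f w‖)) := by ring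
    _ ≤ _ := mul_le_mul_of_nonneg_left (add_le_add k0 k1) (by positivity)

/-- Negation of the frequency variable. -/
def flipFreq (w : Ed d × Ed d) : Ed d × Ed d := (w.1, -w.2)

@[simp] lemma norm_flipFreq (w : Ed d × Ed d) : ‖flipFreq w‖ = ‖w‖ := by
  simp [flipFreq, Prod.norm_def]

lemma continuous_flipFreq : Continuous (flipFreq (d := d)) :=
  continuous_fst.prodMk continuous_snd.neg

lemma integrable_stf_flipFreq (χ f : 𝓢(Ed d, ℂ)) (N : ℕ) :
    Integrable fun w => (1 + ‖w‖) ^ N * ‖stf χ f (flipFreq w)‖ := by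
  set L := Module.finrank ℝ (Ed d × Ed d) + 1 with hL
  obtain ⟨C, hC, h⟩ := stf_decay χ f (N + L)
  have hc : Continuous fun w : Ed d × Ed d => (1 + ‖w‖) ^ N * ‖stf χ f (flipFreq w)‖ :=
    ((continuous_const.add continuous_norm).pow N).mul
      ((continuous_stf χ f).comp continuous_flipFreq).norm
  refine ((integrable_inv_one_add_pow (V := Ed d × Ed d) volume).const_mul C).mono'
    hc.aestronglyMeasurable (Eventually.of_forall fun w => ?_)
  rw [Real.norm_of_nonneg (by positivity), ← div_eq_mul_inv, le_div_iff₀ (by positivity)]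
  have := h (flipFreq w)
  rw [norm_flipFreq, pow_add] at this
  calc _ = _ := by ring
    _ ≤ _ := this

/-- The normalisation constant of the inversion formula. -/
def stfConst (γ χ : 𝓢(Ed d, ℂ)) : ℂ :=
  ((2 * Real.pi) ^ Module.finrank ℝ (Ed d) : ℝ) * ∫ t, γ t * χ t

/-- Inversion formula for the short-time Fourier transform of Schwartz functions. -/
lemma integral_stf_mul_tf (γ χ f : 𝓢(Ed d, ℂ)) (y : Ed d) :
    ∫ w, stf χ f (flipFreq w) * tf γ w y = stfConst γ χ * f y := by
  have hInt : Integrable fun w => stf χ f (flipFreq w) * tf γ w y := by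
    obtain ⟨C, N, hC, h⟩ := seminorm_atom_le (bil d) γ 0 0
    refine ((integrable_stf_flipFreq χ f N).const_mul C).mono'
      (Continuous.aestronglyMeasurable ?_) (Eventually.of_forall fun w => ?_)
    · refine ((continuous_stf χ f).comp continuous_flipFreq).mul ?_
      simp only [tf_apply]
      exact (γ.continuous.comp (by fun_prop)).mul (by fun_prop)
    · have h1 := (SchwartzMap.le_seminorm ℂ 0 0 (atom (bil d) γ w) y).trans (h w)
      rw [pow_zero, one_mul, norm_iteratedFDeriv_zero] at h1
      rw [norm_mul]
      calc _ ≤ ‖stf χ f (flipFreq w)‖ * (C * (1 + ‖w‖) ^ N) :=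
            mul_le_mul_of_nonneg_left h1 (norm_nonneg _)
        _ = _ := by ring
  rw [Measure.volume_eq_prod] at hInt ⊢
  rw [integral_prod _ hInt]
  have inner : ∀ x : Ed d, ∫ ξ, stf χ f (flipFreq (x, ξ)) * tf γ (x, ξ) y =
      ((2 * Real.pi) ^ Module.finrank ℝ (Ed d) : ℝ) * f y * (γ (y - x) * χ (y - x)) := by
    intro x
    set g : 𝓢(Ed d, ℂ) := SchwartzMap.smulLeftCLM ℂ (f : Ed d → ℂ) (tf χ (x, 0)) with hg
    have hgy : ∀ y, g y = f y * χ (y - x) := by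
      intro y
      rw [hg, SchwartzMap.smulLeftCLM_apply_apply f.hasTemperateGrowth, tf_apply]
      simp
    have e1 : ∀ ξ, stf χ f (flipFreq (x, ξ)) =
        FourierTransform.fourierInv (g : Ed d → ℂ) ((2 * Real.pi)⁻¹ • ξ) := by
      intro ξ
      rw [stf_eq, Real.fourierInv_eq']
      refine integral_congr_ae (Eventually.of_forall fun t => ?_)
      simp only [smul_eq_mul, real_inner_smul_right, hgy, flipFreq, inner_neg_right]
      rw [mul_comm]
      congr 2
      have : (Real.pi : ℂ) ≠ 0 := by exact_mod_cast Real.pi_ne_zero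
      push_cast
      field_simp
    have e2 : ∀ ξ, stf χ f (flipFreq (x, ξ)) * tf γ (x, ξ) y = γ (y - x) *
        (fun v => Complex.exp ((-2 * Real.pi * ⟪v, y⟫ : ℝ) * Complex.I) •
          FourierTransform.fourierInv (g : Ed d → ℂ) v) ((2 * Real.pi)⁻¹ • ξ) := by
      intro ξ
      rw [e1, tf_apply]
      simp only [smul_eq_mul, real_inner_smul_left]
      have e3 : -(Complex.I * (⟪y, ξ⟫ : ℝ)) =
          ((-2 * Real.pi * ((2 * Real.pi)⁻¹ * ⟪ξ, y⟫) : ℝ) : ℂ) * Complex.I := by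
        have : (Real.pi : ℂ) ≠ 0 := by exact_mod_cast Real.pi_ne_zero
        rw [real_inner_comm]
        push_cast
        field_simp
      rw [e3]
      ring
    rw [funext e2, integral_const_mul, Measure.integral_comp_inv_smul volume (fun v =>
        Complex.exp ((-2 * Real.pi * ⟪v, y⟫ : ℝ) * Complex.I) •
          FourierTransform.fourierInv (g : Ed d → ℂ) v), ← Real.fourier_eq']
    have hfi : FourierTransform.fourier (FourierTransform.fourierInv (g : Ed d → ℂ)) = g := by
      rw [← SchwartzMap.fourierInv_coe, ← SchwartzMap.fourier_coe,
        FourierTransform.fourier_fourierInv_eq]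
    rw [hfi, hgy, abs_of_pos (by positivity), Complex.real_smul]
    ring
  simp_rw [inner]
  rw [integral_const_mul, integral_sub_left_eq_self (fun t => γ t * χ t) volume y, stfConst]
  ring

/-- Reconstruction of a tempered distribution from its short-time Fourier transform. -/
theorem integral_stf_mul_clm (u : TD d) (γ χ f : 𝓢(Ed d, ℂ)) :
    ∫ w, stf χ f (flipFreq w) * u (tf γ w) = stfConst γ χ * u f := by
  have h := clm_apply_eq_integral_atom (bil d) γ volume u
    (((continuous_stf χ f).comp continuous_flipFreq).aestronglyMeasurable)
    (integrable_stf_flipFreq χ f) (stfConst γ χ • f)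
    (fun y => by
      rw [_root_.smul_apply, smul_eq_mul]
      exact integral_stf_mul_tf γ χ f y)
  rw [map_smul, smul_eq_mul] at h
  exact h

/-! ### Gelfand–Shilov functions through Fréchet derivatives -/

/-- Successive partial derivatives along a list of coordinates. -/
def pdList (L : List (Fin d)) (f : Ed d → ℂ) : Ed d → ℂ := L.foldr pdGS f

lemma pdList_cons (i : Fin d) (L : List (Fin d)) (f : Ed d → ℂ) :
    pdList (i :: L) f = pdGS i (pdList L f) := rfl

lemma pdList_append (L L' : List (Fin d)) (f : Ed d → ℂ) :
    pdList (L ++ L') f = pdList L (pdList L' f) := List.foldr_append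

lemma pdList_replicate (n : ℕ) (i : Fin d) (f : Ed d → ℂ) :
    pdList (List.replicate n i) f = (pdGS i)^[n] f := by
  induction n with
  | zero => rfl
  | succ n ih => rw [List.replicate_succ, pdList_cons, ih, Function.iterate_succ_apply']

lemma mderiv_eq_pdList (β : Fin d → ℕ) (f : Ed d → ℂ) :
    mderiv β f = pdList ((List.finRange d).flatMap fun i => List.replicate (β i) i) f := by
  rw [mderiv, List.ofFn_eq_map]
  induction List.finRange d with
  | nil => rfl
  | cons i l ih =>
    rw [List.map_cons, List.foldr_cons, Function.comp_apply, ih, List.flatMap_cons, pdList_append,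
      pdList_replicate]

lemma pdList_eq_iteratedFDeriv {f : Ed d → ℂ} (hf : ContDiff ℝ ∞ f) (L : List (Fin d)) :
    pdList L f = fun x => iteratedFDeriv ℝ L.length f x
      fun k => EuclideanSpace.single (L.get k) (1 : ℝ) := by
  induction L with
  | nil => funext x; simp [pdList]
  | cons i L ih =>
    funext x
    have hd : DifferentiableAt ℝ (iteratedFDeriv ℝ L.length f) x :=
      hf.differentiable_iteratedFDeriv (mod_cast WithTop.coe_lt_top _) x
    rw [pdList_cons, ih, pdGS]
    have := (hd.hasFDerivAt.continuousMultilinear_apply_const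
      (fun k => EuclideanSpace.single (L.get k) (1 : ℝ))).fderiv
    rw [this]
    change _ = iteratedFDeriv ℝ (L.length + 1) f x _
    rw [iteratedFDeriv_succ_apply_left]
    rfl

lemma contDiff_pdGS {f : Ed d → ℂ} (hf : ContDiff ℝ ∞ f) (i : Fin d) : ContDiff ℝ ∞ (pdGS i f) :=
  (hf.fderiv_right (m := ∞) (by simp)).clm_apply contDiff_const

lemma contDiff_pdList {f : Ed d → ℂ} (hf : ContDiff ℝ ∞ f) (L : List (Fin d)) :
    ContDiff ℝ ∞ (pdList L f) := by
  induction L with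
  | nil => exact hf
  | cons i L ih => exact contDiff_pdGS ih i

lemma pdGS_comm {f : Ed d → ℂ} (hf : ContDiff ℝ ∞ f) (i j : Fin d) :
    pdGS i (pdGS j f) = pdGS j (pdGS i f) := by
  funext x
  have hd : DifferentiableAt ℝ (fderiv ℝ f) x :=
    (hf.fderiv_right (m := ∞) (by simp)).differentiable (by simp) x
  have hs : IsSymmSndFDerivAt ℝ f x := hf.contDiffAt.isSymmSndFDerivAt (by
    simp only [minSmoothness_of_isRCLikeNormedField]
    exact WithTop.coe_le_coe.2 (le_top : (2 : ℕ∞) ≤ ⊤))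
  have key : ∀ i j : Fin d, pdGS i (pdGS j f) x = fderiv ℝ (fderiv ℝ f) x
      (EuclideanSpace.single i 1) (EuclideanSpace.single j 1) := by
    intro i j
    have h : HasFDerivAt (pdGS j f) _ x := hd.hasFDerivAt.clm_apply
      (hasFDerivAt_const (EuclideanSpace.single j (1 : ℝ)) x)
    rw [pdGS, h.fderiv]
    simp
  rw [key, key]
  exact hs _ _

lemma pdList_perm {f : Ed d → ℂ} (hf : ContDiff ℝ ∞ f) {L L' : List (Fin d)} (h : L.Perm L') :
    pdList L f = pdList L' f := by
  induction h with
  | nil => rfl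
  | cons i _ ih => rw [pdList_cons, pdList_cons, ih]
  | swap i j L => exact pdGS_comm (contDiff_pdList hf L) j i
  | trans _ _ ih1 ih2 => exact ih1.trans ih2

lemma length_flatMap_replicate (β : Fin d → ℕ) :
    ((List.finRange d).flatMap fun i => List.replicate (β i) i).length = mlen β := by
  rw [List.length_flatMap, mlen]
  simp only [List.length_replicate]
  rw [← List.ofFn_eq_map, List.sum_ofFn]

lemma norm_mderiv_le {f : Ed d → ℂ} (hf : ContDiff ℝ ∞ f) (β : Fin d → ℕ) (x : Ed d) :
    ‖mderiv β f x‖ ≤ ‖iteratedFDeriv ℝ (mlen β) f x‖ := by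
  rw [mderiv_eq_pdList, pdList_eq_iteratedFDeriv hf, ← length_flatMap_replicate]
  refine (ContinuousMultilinearMap.le_opNorm _ _).trans (le_of_eq ?_)
  simp

lemma iteratedFDeriv_single_eq_mderiv {f : Ed d → ℂ} (hf : ContDiff ℝ ∞ f) {n : ℕ}
    (ι : Fin n → Fin d) (x : Ed d) : ∃ β : Fin d → ℕ, mlen β = n ∧
      iteratedFDeriv ℝ n f x (fun k => EuclideanSpace.single (ι k) (1 : ℝ)) = mderiv β f x := by
  set β : Fin d → ℕ := fun i => (List.ofFn ι).count i with hβ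
  have hp : ((List.finRange d).flatMap fun i => List.replicate (β i) i).Perm (List.ofFn ι) := by
    rw [List.perm_iff_count]
    intro a
    rw [List.count_flatMap]
    have : (List.count a ∘ fun i => List.replicate (β i) i) = fun i => if i = a then β a else 0 := by
      funext i
      simp only [Function.comp_apply, List.count_replicate, beq_iff_eq]
      split_ifs with h
      · rw [h]
      · rfl
    rw [this, ← List.ofFn_eq_map, List.sum_ofFn]
    simp [hβ]
  refine ⟨β, ?_, ?_⟩
  · rw [← length_flatMap_replicate, hp.length_eq, List.length_ofFn]
  · rw [mderiv_eq_pdList, pdList_perm hf hp, pdList_eq_iteratedFDeriv hf]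
    have : ∀ (L : List (Fin d)) (e : L.length = n) , (∀ k, L.get k = ι (Fin.cast e k)) →
        iteratedFDeriv ℝ n f x (fun k => EuclideanSpace.single (ι k) (1 : ℝ)) =
        iteratedFDeriv ℝ L.length f x fun k => EuclideanSpace.single (L.get k) (1 : ℝ) := by
      rintro L rfl h
      congr 1
      funext k
      rw [h]
      rfl
    exact this _ List.length_ofFn fun k => by simp; rfl

lemma mfact_le_factorial (β : Fin d → ℕ) : mfact β ≤ (mlen β).factorial :=
  Nat.le_of_dvd (Nat.factorial_pos _) (Nat.prod_factorial_dvd_factorial_sum _ _)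

lemma factorial_mlen_le (β : Fin d → ℕ) : (mlen β).factorial ≤ (2 ^ d) ^ mlen β * mfact β := by
  have h : ∀ S : Finset (Fin d), (∑ i ∈ S, β i).factorial ≤
      (2 ^ S.card) ^ (∑ i ∈ S, β i) * ∏ i ∈ S, (β i).factorial := by
    intro S
    induction S using Finset.induction_on with
    | empty => simp
    | insert a S ha ih =>
      rw [Finset.sum_insert ha, Finset.prod_insert ha, Finset.card_insert_of_notMem ha]
      set b := ∑ i ∈ S, β i
      have h1 : (β a + b).factorial ≤ 2 ^ (β a + b) * ((β a).factorial * b.factorial) := by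
        rw [← Nat.add_choose_mul_factorial_mul_factorial, mul_assoc]
        exact Nat.mul_le_mul_right _ (Nat.choose_le_two_pow _ _)
      calc _ ≤ _ := h1
        _ ≤ 2 ^ (β a + b) * ((β a).factorial * ((2 ^ S.card) ^ b * ∏ i ∈ S, (β i).factorial)) := by
            gcongr
        _ ≤ 2 ^ (β a + b) * ((β a).factorial *
              ((2 ^ S.card) ^ (β a + b) * ∏ i ∈ S, (β i).factorial)) := by
            gcongr
            · exact Nat.one_le_two_pow
            · exact Nat.le_add_left _ _
        _ = _ := by rw [pow_succ 2 S.card, mul_pow]; ring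
  simpa [mlen, mfact] using h Finset.univ

lemma norm_multilinear_le_of_single {n : ℕ} (M : ContinuousMultilinearMap ℝ (fun _ : Fin n => Ed d) ℂ)
    {c : ℝ} (hc : 0 ≤ c)
    (h : ∀ ι : Fin n → Fin d, ‖M fun k => EuclideanSpace.single (ι k) (1 : ℝ)‖ ≤ c) :
    ‖M‖ ≤ (d : ℝ) ^ n * c := by
  refine ContinuousMultilinearMap.opNorm_le_bound (by positivity) fun v => ?_
  have hv : v = fun k => ∑ i : Fin d, v k i • EuclideanSpace.single i (1 : ℝ) := by
    funext k
    ext j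
    simp [Finset.sum_apply, Pi.single_apply]
  have e : M v = ∑ ι : Fin n → Fin d, (∏ k, v k (ι k)) •
      M fun k => EuclideanSpace.single (ι k) (1 : ℝ) := by
    conv_lhs => rw [hv]
    rw [M.map_sum]
    refine Finset.sum_congr rfl fun ι _ => ?_
    exact M.map_smul_univ (fun k => v k (ι k)) _
  rw [e]
  calc _ ≤ ∑ ι : Fin n → Fin d, (∏ k, ‖v k‖) * c := by
        refine (norm_sum_le _ _).trans (Finset.sum_le_sum fun ι _ => ?_)
        rw [norm_smul, norm_prod]
        refine mul_le_mul ?_ (h ι) (norm_nonneg _) (by positivity)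
        exact Finset.prod_le_prod (fun _ _ => norm_nonneg _) fun k _ => PiLp.norm_apply_le (v k) _
    _ = _ := by
        simp
        ring

/-- Exponential-type control of all derivatives, equivalent to membership in `SigmaGS`. -/
def GSDecay (s : ℝ) (f : Ed d → ℂ) : Prop :=
  ContDiff ℝ ∞ f ∧ ∀ h : ℝ, 0 < h → ∀ A : ℝ, 0 < A → ∃ C : ℝ, 0 ≤ C ∧ ∀ (n : ℕ) (x : Ed d),
    ‖iteratedFDeriv ℝ n f x‖ ≤
      C * Real.exp (-(A * ‖x‖ ^ (1 / s))) * (h ^ n * (n.factorial : ℝ) ^ s)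

lemma exists_bound_of_GSnorm_lt_top {s h : ℝ} (hh : 0 < h) {f : Ed d → ℂ}
    (hf : GSnorm s h f < ⊤) : ∃ C : ℝ, 0 ≤ C ∧ ∀ x α β, |mpow x α| * ‖mderiv β f x‖ ≤
      C * (h ^ (mlen α + mlen β) * ((mfact α : ℝ) * (mfact β : ℝ)) ^ s) := by
  refine ⟨(GSnorm s h f).toReal, ENNReal.toReal_nonneg, fun x α β => ?_⟩
  have hpos : ∀ α : Fin d → ℕ, (0 : ℝ) < mfact α := fun α => by
    exact_mod_cast Finset.prod_pos fun i _ => Nat.factorial_pos _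
  have h2 : 0 < h ^ (mlen α + mlen β) * ((mfact α : ℝ) * (mfact β : ℝ)) ^ s :=
    mul_pos (pow_pos hh _) (Real.rpow_pos_of_pos (mul_pos (hpos α) (hpos β)) _)
  rw [← div_le_iff₀ h2, ← ENNReal.ofReal_le_iff_le_toReal hf.ne]
  exact le_iSup_of_le x (le_iSup_of_le α (le_iSup_of_le β le_rfl))

lemma norm_le_mul_abs_apply {x : Ed d} (hx : x ≠ 0) : ∃ l, ‖x‖ ≤ (d + 1) * |x l| := by
  by_contra! hcon
  have h1 : ‖x‖ ≤ ∑ l, |x l| := by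
    have hv : x = ∑ i : Fin d, x i • EuclideanSpace.single i (1 : ℝ) := by
      ext j
      simp [Finset.sum_apply, Pi.single_apply]
    conv_lhs => rw [hv]
    refine (norm_sum_le _ _).trans (le_of_eq (Finset.sum_congr rfl fun i _ => ?_))
    rw [norm_smul]
    simp
  have h2 : (d + 1) * ∑ l, |x l| ≤ d * ‖x‖ := by
    rw [Finset.mul_sum]
    refine (Finset.sum_le_sum fun i _ => (hcon i).le).trans (le_of_eq ?_)
    simp
  have h3 : 0 < ‖x‖ := norm_pos_iff.2 hx
  have : ((d : ℝ) + 1) * ‖x‖ ≤ (d + 1) * ∑ l, |x l| :=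
    mul_le_mul_of_nonneg_left h1 (by positivity)
  linarith

lemma GSDecay.of_mem_SigmaGS {s : ℝ} (hs : 0 < s) {f : Ed d → ℂ} (hf : f ∈ SigmaGS s d) :
    GSDecay s f := by
  refine ⟨hf.1, fun h hh A hA => ?_⟩
  -- a small parameter controlling both the derivatives and the decay
  obtain ⟨h0, hh0, hh0h, hh0A⟩ : ∃ h0 : ℝ, 0 < h0 ∧ (d + 1) * h0 ≤ h ∧
      A ≤ s / 2 * (((d + 1) * h0)⁻¹) ^ (1 / s) := by
    set k : ℝ := min h ((2 * A / s) ^ s)⁻¹ with hk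
    have hk0 : 0 < k := lt_min hh (by positivity)
    refine ⟨k / (d + 1), by positivity, ?_, ?_⟩
    · rw [mul_div_cancel₀ _ (by positivity)]
      exact min_le_left _ _
    · rw [mul_div_cancel₀ _ (by positivity)]
      have : (2 * A / s) ^ s ≤ k⁻¹ := by
        rw [← inv_inv ((2 * A / s) ^ s)]
        exact inv_anti₀ hk0 (min_le_right _ _)
      have h2 := Real.rpow_le_rpow (by positivity) this (by positivity : 0 ≤ 1 / s)
      rw [← Real.rpow_mul (by positivity), mul_one_div_cancel hs.ne', Real.rpow_one] at h2
      calc A = s / 2 * (2 * A / s) := by field_simp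
        _ ≤ _ := mul_le_mul_of_nonneg_left h2 (by positivity)
  obtain ⟨C, hC, hb⟩ := exists_bound_of_GSnorm_lt_top hh0 (hf.2 h0 hh0)
  refine ⟨max 1 (2 ^ s) * C, by positivity, fun n x => ?_⟩
  have hmain : ∀ ι : Fin n → Fin d,
      ‖iteratedFDeriv ℝ n f x fun k => EuclideanSpace.single (ι k) (1 : ℝ)‖ ≤
      max 1 (2 ^ s) * C * Real.exp (-(A * ‖x‖ ^ (1 / s))) *
        (h0 ^ n * (n.factorial : ℝ) ^ s) := by
    intro ι
    obtain ⟨β, hβ, e⟩ := iteratedFDeriv_single_eq_mderiv hf.1 ι x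
    rw [e]
    have hfac : ((mfact β : ℝ)) ^ s ≤ (n.factorial : ℝ) ^ s := by
      refine Real.rpow_le_rpow (by positivity) ?_ hs.le
      rw [← hβ]
      exact_mod_cast mfact_le_factorial β
    by_cases hx : x = 0
    · have := hb x 0 β
      have m0 : mpow x 0 = 1 := by simp [mpow]
      have l0 : mlen (0 : Fin d → ℕ) = 0 := by simp [mlen]
      have f0 : mfact (0 : Fin d → ℕ) = 1 := by simp [mfact]
      rw [m0, l0, f0, abs_one, one_mul, zero_add, Nat.cast_one, one_mul, hβ] at this
      have h0s : (0 : ℝ) ^ (1 / s) = 0 := Real.zero_rpow (by positivity)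
      rw [hx, norm_zero, h0s, mul_zero, neg_zero, Real.exp_zero, mul_one, ← hx]
      calc _ ≤ _ := this
        _ ≤ C * (h0 ^ n * (n.factorial : ℝ) ^ s) := by gcongr
        _ ≤ _ := by
            rw [mul_assoc]
            exact le_mul_of_one_le_left (by positivity) (le_max_left _ _)
    · obtain ⟨l, hl⟩ := norm_le_mul_abs_apply hx
      have hk : ∀ k : ℕ, ‖x‖ ^ k * ‖mderiv β f x‖ ≤ (C * (h0 ^ n * (n.factorial : ℝ) ^ s)) *
          (((d + 1) * h0) ^ k * (k.factorial : ℝ) ^ s) := by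
        intro k
        have := hb x (Pi.single l k) β
        have m0 : mpow x (Pi.single l k) = x l ^ k := by
          rw [mpow, Finset.prod_eq_single l]
          · simp
          · intro i _ hi; simp [hi]
          · simp
        have l0 : mlen (Pi.single l k : Fin d → ℕ) = k := by simp [mlen]
        have f0 : mfact (Pi.single l k : Fin d → ℕ) = k.factorial := by
          rw [mfact, Finset.prod_eq_single l]
          · simp
          · intro i _ hi; simp [hi]
          · simp
        rw [m0, l0, f0, hβ, abs_pow] at this
        calc _ ≤ ((d + 1) * |x l|) ^ k * ‖mderiv β f x‖ := by gcongr
          _ = (d + 1) ^ k * (|x l| ^ k * ‖mderiv β f x‖) := by rw [mul_pow]; ring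
          _ ≤ (d + 1) ^ k * (C * (h0 ^ (k + n) * ((k.factorial : ℝ) * (mfact β : ℝ)) ^ s)) :=
              mul_le_mul_of_nonneg_left this (by positivity)
          _ = (C * (h0 ^ n * (mfact β : ℝ) ^ s)) *
                (((d + 1) * h0) ^ k * (k.factorial : ℝ) ^ s) := by
              rw [Real.mul_rpow (by positivity) (by positivity), pow_add, mul_pow]; ring
          _ ≤ _ := by gcongr
      have := exp_decay_of_pow_mul_le hs (norm_nonneg _) (norm_nonneg x) (by positivity)
        (by positivity) hk
      refine this.trans ?_
      have hexp : Real.exp (-(s / 2 * (‖x‖ / ((d + 1) * h0)) ^ (1 / s))) ≤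
          Real.exp (-(A * ‖x‖ ^ (1 / s))) := by
        refine Real.exp_le_exp.2 (neg_le_neg ?_)
        rw [div_eq_inv_mul ‖x‖, Real.mul_rpow (by positivity) (by positivity), ← mul_assoc]
        exact mul_le_mul_of_nonneg_right hh0A (by positivity)
      calc _ ≤ max 1 (2 ^ s) * (C * (h0 ^ n * (n.factorial : ℝ) ^ s)) *
            Real.exp (-(A * ‖x‖ ^ (1 / s))) := by
              refine mul_le_mul ?_ hexp (Real.exp_nonneg _) (by positivity)
              exact mul_le_mul_of_nonneg_right (le_max_right _ _) (by positivity)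
        _ = _ := by ring
  refine (norm_multilinear_le_of_single _ (by positivity) hmain).trans ?_
  calc _ = max 1 (2 ^ s) * C * Real.exp (-(A * ‖x‖ ^ (1 / s))) *
        ((d * h0) ^ n * (n.factorial : ℝ) ^ s) := by rw [mul_pow]; ring
    _ ≤ _ := by
        have : (d : ℝ) * h0 ≤ h := by nlinarith
        gcongr

/-! ### Stability properties of Gelfand–Shilov functions -/

lemma exists_pow_mul_exp_le {s h : ℝ} (hs : 0 < s) (hh : 0 < h) :
    ∃ A, 0 < A ∧ ∀ (m : ℕ) (t : ℝ), 0 ≤ t →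
      t ^ m * Real.exp (-(A * t ^ (1 / s))) ≤ h ^ m * (m.factorial : ℝ) ^ s := by
  refine ⟨s * (h⁻¹) ^ (1 / s), by positivity, fun m t ht => ?_⟩
  set τ := (h⁻¹ * t) ^ (1 / s) with hτ
  have hτ0 : 0 ≤ τ := by positivity
  have h1 : τ ^ m ≤ m.factorial * Real.exp τ := by
    have := Real.pow_div_factorial_le_exp τ hτ0 m
    rwa [div_le_iff₀ (by positivity), mul_comm] at this
  have h2 := Real.rpow_le_rpow (by positivity) h1 hs.le
  rw [Real.mul_rpow (by positivity) (by positivity), ← Real.exp_mul, ← Real.rpow_natCast,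
    ← Real.rpow_mul hτ0, mul_comm (m : ℝ), Real.rpow_mul hτ0] at h2
  have h5 : τ ^ s = h⁻¹ * t := by
    rw [hτ, ← Real.rpow_mul (by positivity), one_div_mul_cancel hs.ne', Real.rpow_one]
  rw [h5, Real.rpow_natCast] at h2
  have h3 : s * (h⁻¹) ^ (1 / s) * t ^ (1 / s) = τ * s := by
    rw [hτ, Real.mul_rpow (by positivity) ht]; ring
  rw [h3, Real.exp_neg]
  have h4 : t ^ m = h ^ m * (h⁻¹ * t) ^ m := by
    rw [← mul_pow, mul_inv_cancel_left₀ hh.ne']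
  rw [← div_eq_mul_inv, div_le_iff₀ (Real.exp_pos _), h4, mul_assoc]
  exact mul_le_mul_of_nonneg_left h2 (by positivity)

lemma exists_pow_le_mul_factorial_rpow {s h c : ℝ} (hs : 0 < s) (hh : 0 < h) (hc : 0 ≤ c) :
    ∃ C, 0 ≤ C ∧ ∀ m : ℕ, c ^ m ≤ C * (h ^ m * (m.factorial : ℝ) ^ s) := by
  obtain ⟨A, hA, H⟩ := exists_pow_mul_exp_le hs hh
  refine ⟨Real.exp (A * c ^ (1 / s)), (Real.exp_pos _).le, fun m => ?_⟩
  have := H m c hc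
  rwa [Real.exp_neg, ← div_eq_mul_inv, div_le_iff₀ (Real.exp_pos _), mul_comm _ (Real.exp _)]
    at this

lemma factorial_rpow_mul_le {s : ℝ} (hs : 0 ≤ s) {i j : ℕ} (hj : j ≤ i) :
    (j.factorial : ℝ) ^ s * ((i - j).factorial : ℝ) ^ s ≤ (i.factorial : ℝ) ^ s := by
  rw [← Real.mul_rpow (by positivity) (by positivity)]
  refine Real.rpow_le_rpow (by positivity) ?_ hs
  exact_mod_cast Nat.le_of_dvd (Nat.factorial_pos _) (Nat.factorial_mul_factorial_dvd_factorial hj)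

lemma rpow_norm_le_add {E : Type*} [NormedAddCommGroup E] {σ : ℝ} (hσ : 0 ≤ σ) (a b : E) :
    ‖a + b‖ ^ σ ≤ 2 ^ σ * (‖a‖ ^ σ + ‖b‖ ^ σ) := by
  have h1 : ‖a + b‖ ≤ 2 * max ‖a‖ ‖b‖ := by
    have := norm_add_le a b
    linarith [le_max_left ‖a‖ ‖b‖, le_max_right ‖a‖ ‖b‖]
  refine (Real.rpow_le_rpow (norm_nonneg _) h1 hσ).trans ?_
  rw [Real.mul_rpow (by norm_num) (by positivity)]
  refine mul_le_mul_of_nonneg_left ?_ (by positivity)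
  rcases le_total ‖a‖ ‖b‖ with h | h
  · rw [max_eq_right h]; exact le_add_of_nonneg_left (by positivity)
  · rw [max_eq_left h]; exact le_add_of_nonneg_right (by positivity)

lemma GSDecay.mem_SigmaGS {s : ℝ} (hs : 0 < s) {f : Ed d → ℂ} (hf : GSDecay s f) :
    f ∈ SigmaGS s d := by
  refine ⟨hf.1, fun h hh => ?_⟩
  set κ : ℝ := (2 ^ d) ^ s with hκ
  have hκ0 : 0 < κ := by positivity
  obtain ⟨A, hA, hA'⟩ := exists_pow_mul_exp_le hs (div_pos hh hκ0)
  obtain ⟨C, hC, hb⟩ := hf.2 (h / κ) (div_pos hh hκ0) A hA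
  have hfac : ∀ α : Fin d → ℕ, (h / κ) ^ mlen α * ((mlen α).factorial : ℝ) ^ s ≤
      h ^ mlen α * (mfact α : ℝ) ^ s := by
    intro α
    have h1 : ((mlen α).factorial : ℝ) ^ s ≤ κ ^ mlen α * (mfact α : ℝ) ^ s := by
      have : ((mlen α).factorial : ℝ) ≤ (2 ^ d) ^ mlen α * (mfact α : ℝ) := by
        exact_mod_cast factorial_mlen_le α
      refine (Real.rpow_le_rpow (by positivity) this hs.le).trans (le_of_eq ?_)
      rw [Real.mul_rpow (by positivity) (by positivity), hκ,
        ← Real.rpow_natCast _ (mlen α), ← Real.rpow_natCast _ (mlen α),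
        ← Real.rpow_mul (by positivity), ← Real.rpow_mul (by positivity), mul_comm s]
    calc _ ≤ (h / κ) ^ mlen α * (κ ^ mlen α * (mfact α : ℝ) ^ s) :=
          mul_le_mul_of_nonneg_left h1 (by positivity)
      _ = _ := by rw [← mul_assoc, ← mul_pow, div_mul_cancel₀ _ hκ0.ne']
  have hmp : ∀ (x : Ed d) (α : Fin d → ℕ), |mpow x α| ≤ ‖x‖ ^ mlen α := by
    intro x α
    rw [mpow, Finset.abs_prod, mlen, ← Finset.prod_pow_eq_pow_sum]
    refine Finset.prod_le_prod (fun i _ => abs_nonneg _) fun i _ => ?_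
    rw [abs_pow]
    exact pow_le_pow_left₀ (abs_nonneg _) (by simpa using PiLp.norm_apply_le x i) _
  refine lt_of_le_of_lt (b := ENNReal.ofReal C) ?_ ENNReal.ofReal_lt_top
  refine iSup_le fun x => iSup_le fun α => iSup_le fun β => ENNReal.ofReal_le_ofReal ?_
  have hpos : ∀ α : Fin d → ℕ, (0 : ℝ) < mfact α := fun α => by
    exact_mod_cast Finset.prod_pos fun i _ => Nat.factorial_pos _
  have h2 : 0 < h ^ (mlen α + mlen β) * ((mfact α : ℝ) * (mfact β : ℝ)) ^ s :=
    mul_pos (pow_pos hh _) (Real.rpow_pos_of_pos (mul_pos (hpos α) (hpos β)) _)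
  rw [div_le_iff₀ h2]
  calc _ ≤ ‖x‖ ^ mlen α * (C * Real.exp (-(A * ‖x‖ ^ (1 / s))) *
          ((h / κ) ^ mlen β * ((mlen β).factorial : ℝ) ^ s)) :=
        mul_le_mul (hmp x α) ((norm_mderiv_le hf.1 β x).trans (hb _ x)) (norm_nonneg _)
          (by positivity)
    _ = C * ((‖x‖ ^ mlen α * Real.exp (-(A * ‖x‖ ^ (1 / s)))) *
          ((h / κ) ^ mlen β * ((mlen β).factorial : ℝ) ^ s)) := by ring
    _ ≤ C * ((h ^ mlen α * (mfact α : ℝ) ^ s) * (h ^ mlen β * (mfact β : ℝ) ^ s)) := by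
        refine mul_le_mul_of_nonneg_left ?_ hC
        exact mul_le_mul ((hA' _ _ (norm_nonneg x)).trans (hfac α)) (hfac β) (by positivity)
          (by positivity)
    _ = _ := by
        rw [Real.mul_rpow (hpos α).le (hpos β).le, pow_add]; ring

/-- A Gelfand–Shilov function as a Schwartz function. -/
def GSDecay.toSchwartz {s : ℝ} (hs : 0 < s) {f : Ed d → ℂ} (hf : GSDecay s f) : 𝓢(Ed d, ℂ) where
  toFun := f
  smooth' := hf.1
  decay' k n := by
    obtain ⟨A, hA, hA'⟩ := exists_pow_mul_exp_le hs one_pos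
    obtain ⟨C, hC, hb⟩ := hf.2 1 one_pos A hA
    refine ⟨C * (k.factorial : ℝ) ^ s * (n.factorial : ℝ) ^ s, fun x => ?_⟩
    have h1 := hA' k ‖x‖ (norm_nonneg x)
    rw [one_pow, one_mul] at h1
    have h2 := hb n x
    rw [one_pow, one_mul] at h2
    calc _ ≤ ‖x‖ ^ k * (C * Real.exp (-(A * ‖x‖ ^ (1 / s))) * (n.factorial : ℝ) ^ s) :=
          mul_le_mul_of_nonneg_left h2 (by positivity)
      _ = C * (‖x‖ ^ k * Real.exp (-(A * ‖x‖ ^ (1 / s)))) * (n.factorial : ℝ) ^ s := by ring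
      _ ≤ _ := by
          refine mul_le_mul_of_nonneg_right ?_ (by positivity)
          exact mul_le_mul_of_nonneg_left h1 hC

lemma GSDecay.conj {s : ℝ} {f : Ed d → ℂ} (hf : GSDecay s f) :
    GSDecay s fun x => (starRingEnd ℂ) (f x) := by
  have e : (fun x => (starRingEnd ℂ) (f x)) = Complex.conjLIE ∘ f := rfl
  rw [e]
  refine ⟨Complex.conjLIE.contDiff.comp hf.1, fun h hh A hA => ?_⟩
  obtain ⟨C, hC, hb⟩ := hf.2 h hh A hA
  refine ⟨C, hC, fun n x => ?_⟩
  rw [LinearIsometryEquiv.norm_iteratedFDeriv_comp_left]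
  exact hb n x

lemma norm_iteratedFDeriv_phase_le (ξ : Ed d) (n : ℕ) (y : Ed d) :
    ‖iteratedFDeriv ℝ n (fun y : Ed d => Complex.exp (-(Complex.I * (⟪y, ξ⟫ : ℝ)))) y‖ ≤
      ‖ξ‖ ^ n := by
  have e : (fun y : Ed d => Complex.exp (-(Complex.I * (⟪y, ξ⟫ : ℝ)))) =
      (fun t : ℝ => Complex.exp (-(Complex.I * (t : ℝ)))) ∘ (innerSL ℝ ξ : Ed d →L[ℝ] ℝ) := by
    funext y
    simp [real_inner_comm]
  rw [e, ContinuousLinearMap.iteratedFDeriv_comp_right _ contDiff_cexp_neg_I_mul _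
    (by exact_mod_cast le_top)]
  refine (ContinuousMultilinearMap.norm_compContinuousLinearMap_le _ _).trans ?_
  rw [norm_iteratedFDeriv_cexp_neg_I_mul, one_mul]
  simp

lemma contDiff_phase (ξ : Ed d) :
    ContDiff ℝ ∞ fun y : Ed d => Complex.exp (-(Complex.I * (⟪y, ξ⟫ : ℝ))) := by
  have : ContDiff ℝ ∞ fun y : Ed d => ⟪y, ξ⟫ := contDiff_id.inner ℝ contDiff_const
  exact contDiff_cexp_neg_I_mul.comp this

lemma GSDecay.tf {s : ℝ} (hs : 0 < s) {f : 𝓢(Ed d, ℂ)} (hf : GSDecay s f) (w : Ed d × Ed d) :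
    GSDecay s (tf f w) := by
  refine ⟨(GelfandShilov.tf f w).smooth ⊤, fun h hh A hA => ?_⟩
  obtain ⟨C, hC, hb⟩ := hf.2 (h / 2) (by positivity) (2 ^ (1 / s) * A) (by positivity)
  obtain ⟨D, hD, hD'⟩ := exists_pow_le_mul_factorial_rpow hs (half_pos hh) (norm_nonneg w.2)
  refine ⟨D * C * Real.exp (2 ^ (1 / s) * A * ‖w.1‖ ^ (1 / s)), by positivity, fun n y => ?_⟩
  have e : (GelfandShilov.tf f w : Ed d → ℂ) =
      fun y => (fun y : Ed d => Complex.exp (-(Complex.I * (⟪y, w.2⟫ : ℝ)))) y * f (y - w.1) := by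
    funext y; rw [tf_apply, mul_comm]
  rw [e]
  refine (norm_iteratedFDeriv_mul_translate_le (contDiff_phase w.2) hf.1 w.1 y hD
    (Q := C * Real.exp (-(2 ^ (1 / s) * A * ‖y - w.1‖ ^ (1 / s)))) (by positivity)
    (fun j => (h / 2) ^ j * (j.factorial : ℝ) ^ s) (fun j => by positivity) n (fun j hj => ?_)
    (fun j hj => (norm_iteratedFDeriv_phase_le _ _ _).trans (hD' j)) fun j _ => hb j _).trans ?_
  · calc _ = ((h / 2) ^ j * (h / 2) ^ (n - j)) *
          ((j.factorial : ℝ) ^ s * ((n - j).factorial : ℝ) ^ s) := by ring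
      _ ≤ _ := by
          rw [← pow_add, Nat.add_sub_cancel' hj]
          exact mul_le_mul_of_nonneg_left (factorial_rpow_mul_le hs.le hj) (by positivity)
  · have hexp : Real.exp (-(2 ^ (1 / s) * A * ‖y - w.1‖ ^ (1 / s))) ≤
        Real.exp (2 ^ (1 / s) * A * ‖w.1‖ ^ (1 / s)) * Real.exp (-(A * ‖y‖ ^ (1 / s))) := by
      rw [← Real.exp_add]
      refine Real.exp_le_exp.2 ?_
      have := rpow_norm_le_add (by positivity : 0 ≤ 1 / s) (y - w.1) w.1
      rw [sub_add_cancel] at this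
      nlinarith
    calc _ = D * C * Real.exp (-(2 ^ (1 / s) * A * ‖y - w.1‖ ^ (1 / s))) *
          (h ^ n * (n.factorial : ℝ) ^ s) := by
            have : (2 : ℝ) ^ n * (h / 2) ^ n = h ^ n := by rw [← mul_pow]; congr 1; ring
            rw [← this]; ring
      _ ≤ D * C * (Real.exp (2 ^ (1 / s) * A * ‖w.1‖ ^ (1 / s)) *
          Real.exp (-(A * ‖y‖ ^ (1 / s)))) * (h ^ n * (n.factorial : ℝ) ^ s) := by
            refine mul_le_mul_of_nonneg_right ?_ (by positivity)
            exact mul_le_mul_of_nonneg_left hexp (by positivity)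
      _ = _ := by ring

/-- Joint position decay and frequency regularity of the short-time Fourier transform. -/
lemma pow_mul_norm_stf_le {s : ℝ} (hs : 0 < s) {χ f : 𝓢(Ed d, ℂ)} (hχ : GSDecay s χ)
    (hf : GSDecay s f) {h A : ℝ} (hh : 0 < h) (hA : 0 < A) :
    ∃ C, 0 ≤ C ∧ ∀ (w : Ed d × Ed d) (n : ℕ), ‖w.2‖ ^ n * ‖stf χ f w‖ ≤
      C * Real.exp (-(A * ‖w.1‖ ^ (1 / s))) * (h ^ n * (n.factorial : ℝ) ^ s) := by
  have hpi := Real.pi_pos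
  set k : ℝ := h / (16 * Real.pi) with hk
  have hk0 : 0 < k := by positivity
  have hσ : 0 < 1 / s := by positivity
  set A1 : ℝ := 2 ^ (1 / s) * A + 1 with hA1
  have hA10 : 0 < A1 := by positivity
  obtain ⟨Cf, hCf, hbf⟩ := hf.2 k hk0 A1 hA10
  obtain ⟨Cχ, hCχ, hbχ⟩ := hχ.2 k hk0 A1 hA10
  obtain ⟨D, hD, hbD⟩ := exists_pow_le_mul_factorial_rpow (c := k⁻¹) hs one_pos (by positivity)
  have hI : Integrable fun y : Ed d => Real.exp (-(1 * ‖y‖ ^ (1 / s))) :=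
    integrable_exp_neg_norm_rpow volume hσ one_pos
  set J : ℝ := ∫ y : Ed d, Real.exp (-(1 * ‖y‖ ^ (1 / s))) with hJ
  have hJ0 : 0 ≤ J := integral_nonneg fun y => (Real.exp_pos _).le
  set r : ℕ → ℝ := fun j => k ^ j * (j.factorial : ℝ) ^ s with hr
  have hr0 : ∀ j, 0 ≤ r j := fun j => by positivity
  have hrr : ∀ i, ∀ j ≤ i, r j * r (i - j) ≤ r i := by
    intro i j hj
    calc _ = (k ^ j * k ^ (i - j)) *
          ((j.factorial : ℝ) ^ s * ((i - j).factorial : ℝ) ^ s) := by simp only [hr]; ring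
      _ ≤ _ := by
          rw [← pow_add, Nat.add_sub_cancel' hj]
          exact mul_le_mul_of_nonneg_left (factorial_rpow_mul_le hs.le hj) (by positivity)
  have hrle : ∀ n, ∀ i ≤ n, r i ≤ D * r n := by
    intro n i hi
    have h1 := hbD (n - i)
    rw [one_pow, one_mul] at h1
    have h2 := factorial_rpow_mul_le hs.le hi
    have h3 : k ^ i = k ^ n * (k⁻¹) ^ (n - i) := by
      rw [inv_pow, eq_mul_inv_iff_mul_eq₀ (by positivity), ← pow_add, Nat.add_sub_cancel' hi]
    calc r i = k ^ n * ((i.factorial : ℝ) ^ s * (k⁻¹) ^ (n - i)) := by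
          simp only [hr]; rw [h3]; ring
      _ ≤ k ^ n * ((i.factorial : ℝ) ^ s * (D * ((n - i).factorial : ℝ) ^ s)) := by gcongr
      _ = D * (k ^ n * ((i.factorial : ℝ) ^ s * ((n - i).factorial : ℝ) ^ s)) := by ring
      _ ≤ _ := by simp only [hr]; gcongr
  refine ⟨Cf * Cχ * D * J, by positivity, fun w n => ?_⟩
  set ρ : Ed d → ℝ := fun y => (2 ^ n * (Cf * Cχ * Real.exp (-(A * ‖w.1‖ ^ (1 / s))) * (D * r n))) *
    Real.exp (-(1 * ‖y‖ ^ (1 / s))) with hρ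
  have hg : ContDiff ℝ ∞ fun y => f y * χ (y - w.1) :=
    hf.1.mul (hχ.1.comp (contDiff_id.sub contDiff_const))
  have hb : ∀ i ≤ n, ∀ y, ‖iteratedFDeriv ℝ i (fun y => f y * χ (y - w.1)) y‖ ≤ ρ y := by
    intro i hi y
    refine (norm_iteratedFDeriv_mul_translate_le hf.1 hχ.1 w.1 y
      (P := Cf * Real.exp (-(A1 * ‖y‖ ^ (1 / s))))
      (Q := Cχ * Real.exp (-(A1 * ‖y - w.1‖ ^ (1 / s)))) (by positivity) (by positivity) r hr0 i
      (hrr i) (fun j _ => hbf j y) fun j _ => hbχ j _).trans ?_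
    have hexp : Real.exp (-(A1 * ‖y‖ ^ (1 / s))) * Real.exp (-(A1 * ‖y - w.1‖ ^ (1 / s))) ≤
        Real.exp (-(A * ‖w.1‖ ^ (1 / s))) * Real.exp (-(1 * ‖y‖ ^ (1 / s))) := by
      rw [← Real.exp_add, ← Real.exp_add]
      refine Real.exp_le_exp.2 ?_
      have h1 := rpow_norm_le_add hσ.le y (w.1 - y)
      rw [add_sub_cancel, norm_sub_rev] at h1
      have h2 : 0 ≤ ‖y - w.1‖ ^ (1 / s) := by positivity
      rw [hA1]
      nlinarith
    calc _ = 2 ^ i * ((Cf * Cχ) * (Real.exp (-(A1 * ‖y‖ ^ (1 / s))) *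
          Real.exp (-(A1 * ‖y - w.1‖ ^ (1 / s)))) * r i) := by ring
      _ ≤ 2 ^ n * ((Cf * Cχ) * (Real.exp (-(A * ‖w.1‖ ^ (1 / s))) *
          Real.exp (-(1 * ‖y‖ ^ (1 / s)))) * (D * r n)) := by
          refine mul_le_mul (pow_le_pow_right₀ (by norm_num) hi) ?_
            (mul_nonneg (by positivity) (hr0 i)) (by positivity)
          refine mul_le_mul ?_ (hrle n i hi) (hr0 i) (by positivity)
          exact mul_le_mul_of_nonneg_left hexp (by positivity)
      _ = _ := by simp only [hρ]; ring
  rw [stf_eq]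
  refine (pow_mul_norm_integral_mul_exp_le hg (hI.const_mul _) n hb w.2).trans ?_
  rw [integral_const_mul, ← hJ]
  have hn : (n : ℝ) + 1 ≤ 2 ^ n := by exact_mod_cast Nat.lt_two_pow_self
  calc _ ≤ (4 * Real.pi) ^ n * 2 ^ n * (2 ^ n * (Cf * Cχ * Real.exp (-(A * ‖w.1‖ ^ (1 / s))) *
          (D * r n)) * J) := by
        refine mul_le_mul_of_nonneg_right ?_ (mul_nonneg (mul_nonneg (by positivity)
          (mul_nonneg (by positivity) (mul_nonneg hD (hr0 n)))) hJ0)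
        exact mul_le_mul_of_nonneg_left hn (by positivity)
    _ = Cf * Cχ * D * J * Real.exp (-(A * ‖w.1‖ ^ (1 / s))) *
          (((4 * Real.pi) * 2 * 2 * k) ^ n * (n.factorial : ℝ) ^ s) := by
        simp only [hr, mul_pow]; ring
    _ = _ := by
        congr 3
        rw [hk]; field_simp; ring

theorem exp_mul_norm_stf_le {s : ℝ} (hs : 0 < s) {χ f : 𝓢(Ed d, ℂ)} (hχ : GSDecay s χ)
    (hf : GSDecay s f) {A : ℝ} (hA : 0 < A) :
    ∃ C, 0 ≤ C ∧ ∀ w : Ed d × Ed d,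
      ‖stf χ f w‖ ≤ C * Real.exp (-(A * ‖w‖ ^ (1 / s))) := by
  have hσ : 0 < 1 / s := by positivity
  set h : ℝ := ((2 * A / s) ^ s)⁻¹ with hh
  have hh0 : 0 < h := by positivity
  obtain ⟨C, hC, hb⟩ := pow_mul_norm_stf_le hs hχ hf hh0 hA
  refine ⟨2 ^ s * C, by positivity, fun w => ?_⟩
  have h1 := exp_decay_of_pow_mul_le hs (norm_nonneg (stf χ f w)) (norm_nonneg w.2)
    (by positivity) hh0 (hb w)
  have h2 : s / 2 * (‖w.2‖ / h) ^ (1 / s) = A * ‖w.2‖ ^ (1 / s) := by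
    rw [hh, div_inv_eq_mul, Real.mul_rpow (by positivity) (by positivity),
      ← Real.rpow_mul (by positivity), mul_one_div_cancel hs.ne', Real.rpow_one]
    field_simp
  rw [h2] at h1
  refine h1.trans ?_
  rw [← mul_assoc, mul_assoc, ← Real.exp_add]
  refine mul_le_mul_of_nonneg_left (Real.exp_le_exp.2 ?_) (by positivity)
  have h3 : ‖w‖ ^ (1 / s) ≤ ‖w.1‖ ^ (1 / s) + ‖w.2‖ ^ (1 / s) := by
    rw [Prod.norm_def]
    rcases le_total ‖w.1‖ ‖w.2‖ with h | h
    · rw [max_eq_right h]; exact le_add_of_nonneg_left (by positivity)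
    · rw [max_eq_left h]; exact le_add_of_nonneg_right (by positivity)
  nlinarith

/-! ### Independence of the wave front set of the window -/

lemma norm_stf_tf_flipFreq (χ f : 𝓢(Ed d, ℂ)) (z w : Ed d × Ed d) :
    ‖stf χ (tf f z) (flipFreq w)‖ = ‖stf χ f (flipFreq (w - z))‖ := by
  rw [stf_eq, stf_eq, ← integral_add_right_eq_self _ z.1]
  have e : ∀ y : Ed d, (tf f z (y + z.1) * χ (y + z.1 - (flipFreq w).1)) *
      Complex.exp (-(Complex.I * (⟪y + z.1, (flipFreq w).2⟫ : ℝ))) =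
      Complex.exp (-(Complex.I * (⟪z.1, z.2 - w.2⟫ : ℝ))) *
        ((f y * χ (y - (flipFreq (w - z)).1)) *
          Complex.exp (-(Complex.I * (⟪y, (flipFreq (w - z)).2⟫ : ℝ)))) := by
    intro y
    have h1 : Complex.exp (-(Complex.I * (⟪y + z.1, z.2⟫ : ℝ))) *
        Complex.exp (-(Complex.I * (⟪y + z.1, -w.2⟫ : ℝ))) =
        Complex.exp (-(Complex.I * (⟪z.1, z.2 - w.2⟫ : ℝ))) *
          Complex.exp (-(Complex.I * (⟪y, -(w.2 - z.2)⟫ : ℝ))) := by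
      rw [← Complex.exp_add, ← Complex.exp_add]
      congr 1
      simp only [inner_add_left, inner_sub_right, inner_neg_right, Complex.ofReal_add,
        Complex.ofReal_sub, Complex.ofReal_neg]
      ring
    have h2 : y + z.1 - w.1 = y - (w.1 - z.1) := by abel
    simp only [tf_apply, flipFreq, Prod.fst_sub, Prod.snd_sub, add_sub_cancel_right]
    rw [h2]
    linear_combination (f y * χ (y - (w.1 - z.1))) * h1
  simp_rw [e]
  rw [integral_const_mul, norm_mul, norm_exp_neg_I_mul, one_mul]

lemma smul_notMem_WFs {s : ℝ} {W : Ed d × Ed d → ℂ} {z₀ : Ed d × Ed d} {t : ℝ} (ht : 0 < t)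
    (h : z₀ ∉ WFs s W) : t • z₀ ∉ WFs s W := by
  rintro ⟨h0, hno⟩
  refine h ⟨fun hz => h0 (by rw [hz, smul_zero]), fun ⟨Γ, h1, h2, h3, h4, h5⟩ => ?_⟩
  exact hno ⟨Γ, h1, h2, h3, h2 t ht _ h4, h5⟩

lemma smul_notMem_WFs2 {m n : ℕ} {s : ℝ} {W : (Ed m × Ed n) × (Ed m × Ed n) → ℂ}
    {z₀ : (Ed m × Ed n) × (Ed m × Ed n)} {t : ℝ} (ht : 0 < t)
    (h : z₀ ∉ WFs2 s W) : t • z₀ ∉ WFs2 s W := by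
  rintro ⟨h0, hno⟩
  refine h ⟨fun hz => h0 (by rw [hz, smul_zero]), fun ⟨Γ, h1, h2, h3, h4, h5⟩ => ?_⟩
  exact hno ⟨Γ, h1, h2, h3, h2 t ht _ h4, h5⟩

/-- Ray decay is not affected by factors of polynomial growth. -/
lemma RayDecay.exists_mul_of_poly {X : Type*} [NormedAddCommGroup X] [NormedSpace ℝ X] {σ : ℝ}
    (hσ : 0 < σ) {f g : X → ℝ} {p₀ : X} (hf0 : ∀ p, 0 ≤ f p) (hf : ∃ N ∈ 𝓝 p₀, RayDecay σ f N)
    (hg : ∃ (C : ℝ) (k : ℕ), 0 ≤ C ∧ ∀ p, g p ≤ C * (1 + ‖p‖) ^ k) :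
    ∃ N ∈ 𝓝 p₀, RayDecay σ (fun p => f p * g p) N := by
  obtain ⟨N, hN, h⟩ := hf
  obtain ⟨C, k, hC, hk⟩ := hg
  refine ⟨N ∩ Metric.ball p₀ 1, inter_mem hN (Metric.ball_mem_nhds _ one_pos),
    (h.mono Set.inter_subset_left).mul_poly hσ hf0 ⟨C * (2 + ‖p₀‖) ^ k, k, fun r hr p hp => ?_⟩⟩
  have hp1 : ‖p‖ ≤ 1 + ‖p₀‖ := by
    have h1 := norm_sub_norm_le p p₀
    have h2 := mem_ball_iff_norm.1 hp.2
    linarith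
  calc _ ≤ C * (1 + ‖r • p‖) ^ k := hk _
    _ ≤ C * ((2 + ‖p₀‖) * (1 + r)) ^ k := by
        refine mul_le_mul_of_nonneg_left (pow_le_pow_left₀ (by positivity) ?_ _) hC
        rw [norm_smul, Real.norm_of_nonneg hr.le]
        nlinarith [norm_nonneg p₀]
    _ = _ := by rw [mul_pow]; ring

lemma exists_rayDecay_comp {X Y : Type*} [NormedAddCommGroup X] [NormedSpace ℝ X]
    [NormedAddCommGroup Y] [NormedSpace ℝ Y] {σ : ℝ} {f : Y → ℝ} (L : X →L[ℝ] Y) {p₀ : X}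
    (hf : ∃ N ∈ 𝓝 (L p₀), RayDecay σ f N) : ∃ N ∈ 𝓝 p₀, RayDecay σ (fun p => f (L p)) N := by
  obtain ⟨N, hN, h⟩ := hf
  refine ⟨L ⁻¹' N, L.continuous.continuousAt.preimage_mem_nhds hN, fun A hA => ?_⟩
  obtain ⟨C, hC⟩ := h A hA
  refine ⟨C, fun r hr p hp => ?_⟩
  simp only [map_smul]
  exact hC r hr _ hp

theorem notMem_WFs_of_window_change {s : ℝ} (hs : 0 < s) (v : TD d) {γ χ γ' : 𝓢(Ed d, ℂ)}
    (hχ : GSDecay s χ) (hγ' : GSDecay s γ') (hc : stfConst γ χ ≠ 0) {z₀ : Ed d × Ed d}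
    (hz : z₀ ∉ WFs s fun w => v (tf γ w)) : z₀ ∉ WFs s fun w => v (tf γ' w) := by
  intro hmem
  have hz0 : z₀ ≠ 0 := hmem.1
  have hσ : 0 < 1 / s := by positivity
  refine notMem_WFs_of_le_integral (W := Ed d × Ed d) volume hs _
    (fun p => ‖v (tf γ p.2)‖ * ‖stf χ γ' (flipFreq (p.2 - p.1))‖) (fun p => by positivity)
    ‖(stfConst γ χ)⁻¹‖ (fun z B hB hle => ?_) (fun t ht w htw => ?_) hmem
  · have h1 := integral_stf_mul_clm v γ χ (tf γ' z)
    have h2 : v (tf γ' z) = (stfConst γ χ)⁻¹ *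
        ∫ w, stf χ (tf γ' z) (flipFreq w) * v (tf γ w) := by
      rw [h1, inv_mul_cancel_left₀ hc]
    rw [h2, norm_mul]
    refine mul_le_mul_of_nonneg_left ?_ (norm_nonneg _)
    refine norm_integral_le_of_norm_le hB (Eventually.of_forall fun w => ?_)
    rw [norm_mul, norm_stf_tf_flipFreq, mul_comm]
    exact hle w
  · by_cases hw : w = t • z₀
    · have ht0 : 0 < t := by
        refine lt_of_le_of_ne ht fun h0 => ?_
        subst h0
        simp [hw] at htw
      have h1 := exists_rayDecay_of_notMem_WFs hs (smul_ne_zero ht0.ne' hz0)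
        (smul_notMem_WFs ht0 hz)
      obtain ⟨C, hC, hb⟩ := exp_mul_norm_stf_le hs hχ hγ' one_pos
      refine RayDecay.exists_mul_of_poly hσ (fun p => norm_nonneg _)
        (exists_rayDecay_comp (f := fun w => ‖v (tf γ w)‖)
          (ContinuousLinearMap.snd ℝ (Ed d × Ed d) (Ed d × Ed d)) (by simpa [hw] using h1))
        ⟨C, 0, hC, fun p => ?_⟩
      refine (hb _).trans ?_
      rw [pow_zero]
      refine mul_le_mul_of_nonneg_left ?_ hC
      rw [Real.exp_le_one_iff, neg_nonpos]
      positivity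
    · have hδ : 0 < ‖w - t • z₀‖ / 2 := by
        have := norm_pos_iff.2 (sub_ne_zero.2 hw)
        positivity
      obtain ⟨C, k, hC, hk⟩ := norm_clm_atom_le (bil d) v γ
      simp_rw [mul_comm ‖v _‖]
      refine RayDecay.exists_mul_of_poly hσ (fun p => norm_nonneg _)
        ⟨{p | ‖w - t • z₀‖ / 2 < ‖p.2 - p.1‖}, ?_, ?_⟩ ⟨C, k, hC, fun p => (hk p.2).trans ?_⟩
      · refine (isOpen_lt continuous_const (by fun_prop)).mem_nhds ?_
        simp only [Set.mem_ofPred_eq]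
        linarith
      · refine RayDecay.of_exp_bound hσ hδ (fun p => norm_nonneg _) (fun p => ‖p.2 - p.1‖)
          (fun A hA => ?_) fun r hr p hp => ?_
        · obtain ⟨C, hC, hb⟩ := exp_mul_norm_stf_le hs hχ hγ' hA
          refine ⟨C, fun r hr p hp => ?_⟩
          have h := hb (flipFreq ((r • p).2 - (r • p).1))
          rw [norm_flipFreq, Real.exp_neg, ← div_eq_mul_inv, le_div_iff₀ (Real.exp_pos _)] at h
          rwa [mul_comm]
        · rw [Prod.smul_fst, Prod.smul_snd, ← smul_sub, norm_smul, Real.norm_of_nonneg hr.le]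
          exact mul_le_mul_of_nonneg_left hp.le hr.le
      · refine mul_le_mul_of_nonneg_left (pow_le_pow_left₀ (by positivity) ?_ _) hC
        have := norm_snd_le p
        linarith

/-! ### Superposition of the kernel -/

lemma pairCLM_comm (f g : 𝓢(Ed d, ℂ)) : pairCLM f g = pairCLM g f := by
  simp only [pairCLM_apply, mul_comm]

/-- Estimate of `T u` tested against `g` from the action of `T` on time-frequency shifts. -/
theorem norm_apply_le_integral_of_majorant {T : TD d → TD d} (hTlin : IsLinearMap ℂ T)
    (hTcont : ∀ (useq : ℕ → TD d) (u : TD d),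
      (∀ g : 𝓢(Ed d, ℂ), Tendsto (fun nn => useq nn g) atTop (𝓝 (u g))) →
      ∀ g : 𝓢(Ed d, ℂ), Tendsto (fun nn => T (useq nn) g) atTop (𝓝 (T u g)))
    (u : TD d) (γ χ g : 𝓢(Ed d, ℂ)) {κ : Ed d × Ed d → ℂ}
    (hκ : ∀ w, T (pairCLM (tf χ (flipFreq w))) g = κ w) (hκc : Continuous κ)
    (hκb : ∃ (C : ℝ) (N : ℕ), 0 ≤ C ∧ ∀ w, ‖κ w‖ ≤ C * (1 + ‖w‖) ^ N)
    {B : Ed d × Ed d → ℝ} (hB : Integrable B) (hle : ∀ w, ‖u (tf γ w)‖ * ‖κ w‖ ≤ B w) :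
    ‖stfConst γ χ‖ * ‖T u g‖ ≤ ∫ w, B w := by
  have hB0 : ∀ w, 0 ≤ B w := fun w => le_trans (by positivity) (hle w)
  obtain ⟨Cκ, N, hCκ, hκb⟩ := hκb
  obtain ⟨CV, NV, hCV, hV⟩ := norm_clm_atom_le (bil d) u γ
  set V : Ed d × Ed d → ℂ := fun w => u (tf γ w) with hVdef
  have hVc : Continuous V := u.continuous.comp (continuous_atom (bil d) γ)
  set L := Module.finrank ℝ (Ed d × Ed d) + 1 with hL
  set M := NV + L with hM
  set ρ : Ed d × Ed d → ℂ := fun w => (((1 + ‖w‖) ^ M : ℝ) : ℂ) with hρ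
  have hρc : Continuous ρ := by fun_prop
  have hρn : ∀ w, ‖ρ w‖ = (1 + ‖w‖) ^ M := fun w => by
    rw [hρ, Complex.norm_real, Real.norm_of_nonneg (by positivity)]
  have hρ0 : ∀ w, ρ w ≠ 0 := fun w => by
    rw [← norm_pos_iff, hρn]; positivity
  set a : Ed d × Ed d → ℂ := fun w => V w / ρ w with ha
  have hac : Continuous a := hVc.div hρc hρ0
  have haρ : ∀ w, a w * ρ w = V w := fun w => div_mul_cancel₀ _ (hρ0 w)
  have hai : Integrable a := by
    refine ((integrable_inv_one_add_pow (V := Ed d × Ed d) volume).const_mul CV).mono'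
      hac.aestronglyMeasurable (Eventually.of_forall fun w => ?_)
    rw [ha, norm_div, hρn, hM, pow_add, div_le_iff₀ (by positivity)]
    calc _ ≤ CV * (1 + ‖w‖) ^ NV := hV w
      _ = _ := by rw [hL]; field_simp
  set am : ℕ → Ed d × Ed d → ℂ := fun m => (Metric.closedBall 0 (m : ℝ)).indicator a with ham
  have hami : ∀ m, Integrable (am m) := fun m => hai.indicator measurableSet_closedBall
  set S := fun n => approxId (Ed d × Ed d) n with hS
  set U : ℕ → ℕ → TD d := fun m n => ∑ v ∈ (S n).range,
    (∫ w in (S n) ⁻¹' {v}, am m w) • (ρ v • pairCLM (tf χ (flipFreq v))) with hU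
  have hUf : ∀ m n f, U m n f = ∫ w, am m w * (ρ (S n w) * stf χ f (flipFreq (S n w))) := by
    intro m n f
    have := integral_smul_simpleFunc volume (hami m) (S n) fun v => ρ v * stf χ f (flipFreq v)
    simp only [smul_eq_mul] at this
    rw [this]
    simp only [hU, sum_apply, _root_.smul_apply, smul_eq_mul, stf,
      pairCLM_comm]
  have hTU : ∀ m n, T (U m n) g = ∫ w, am m w * (ρ (S n w) * κ (S n w)) := by
    intro m n
    have := integral_smul_simpleFunc volume (hami m) (S n) fun v => ρ v * κ v
    simp only [smul_eq_mul] at this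
    rw [this]
    have h2 : T (U m n) = ∑ v ∈ (S n).range,
        (∫ w in (S n) ⁻¹' {v}, am m w) • (ρ v • T (pairCLM (tf χ (flipFreq v)))) := by
      have := map_sum (hTlin.mk' T) (fun v => (∫ w in (S n) ⁻¹' {v}, am m w) •
        (ρ v • pairCLM (tf χ (flipFreq v)))) (S n).range
      simpa only [map_smul, IsLinearMap.mk'_apply] using this
    rw [h2]
    simp only [sum_apply, _root_.smul_apply, smul_eq_mul, hκ]
  have hlim1 : ∀ m, Tendsto (fun n => T (U m n) g) atTop (𝓝 (∫ w, am m w * (ρ w * κ w))) := by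
    intro m
    simp_rw [hTU]
    refine tendsto_integral_approxId volume (hami m).aestronglyMeasurable (N := M + N)
      (H := fun p => ρ p.1 * κ p.1) ?_ (by fun_prop) hCκ fun v w => ?_
    · refine ((hai.norm.const_mul ((1 + (m : ℝ)) ^ (M + N))).mono'
        (Continuous.aestronglyMeasurable (by fun_prop) |>.mul (hami m).aestronglyMeasurable.norm)
        (Eventually.of_forall fun w => ?_))
      rw [Real.norm_of_nonneg (by positivity)]
      by_cases hw : w ∈ Metric.closedBall (0 : Ed d × Ed d) (m : ℝ)
      · simp only [ham, Set.indicator_of_mem hw]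
        have hw' : ‖w‖ ≤ m := by simpa using hw
        gcongr
      · simp only [ham, Set.indicator_of_notMem hw, norm_zero, mul_zero]
        positivity
    · rw [norm_mul, hρn, pow_add _ M N, pow_add _ M N]
      calc _ ≤ (1 + ‖v‖) ^ M * (Cκ * (1 + ‖v‖) ^ N) :=
            mul_le_mul_of_nonneg_left (hκb v) (by positivity)
        _ = Cκ * ((1 + ‖v‖) ^ M * (1 + ‖v‖) ^ N) := by ring
        _ ≤ _ := mul_le_mul_of_nonneg_left (le_add_of_nonneg_right (by positivity)) hCκ
  have hchoose : ∀ m : ℕ, ∃ n, m ≤ n ∧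
      dist (T (U m n) g) (∫ w, am m w * (ρ w * κ w)) < 1 / ((m : ℝ) + 1) := by
    intro m
    have h1 := (Metric.tendsto_nhds.1 (hlim1 m)) (1 / ((m : ℝ) + 1)) (by positivity)
    exact ((eventually_ge_atTop m).and h1).exists
  choose n hmn hdist using hchoose
  have hn : Tendsto n atTop atTop := tendsto_atTop_mono hmn tendsto_id
  have hlim2 : ∀ f, Tendsto (fun m => U m (n m) f) atTop (𝓝 ((stfConst γ χ • u) f)) := by
    intro f
    obtain ⟨C, hC, hst⟩ := stf_decay χ f M
    have e : (stfConst γ χ • u) f = ∫ w, a w * (ρ w * stf χ f (flipFreq w)) := by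
      rw [_root_.smul_apply, smul_eq_mul, ← integral_stf_mul_clm]
      refine integral_congr_ae (Eventually.of_forall fun w => ?_)
      simp only
      rw [← mul_assoc, haρ, mul_comm]
    rw [e]
    simp_rw [hUf]
    have hHc : Continuous fun w => ρ w * stf χ f (flipFreq w) :=
      hρc.mul ((continuous_stf χ f).comp continuous_flipFreq)
    refine tendsto_integral_of_dominated_convergence (fun w => C * ‖a w‖) (fun m => ?_)
      (hai.norm.const_mul C) (fun m => Eventually.of_forall fun w => ?_)
      (Eventually.of_forall fun w => ?_)
    · refine (hami m).aestronglyMeasurable.mul (Measurable.aestronglyMeasurable ?_)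
      exact hHc.measurable.comp (S (n m)).measurable
    · rw [norm_mul, norm_mul, hρn, mul_comm]
      have h1 := hst (flipFreq (S (n m) w))
      rw [norm_flipFreq] at h1
      exact mul_le_mul h1 (norm_indicator_le_norm_self _ _) (norm_nonneg _) hC
    · refine Tendsto.mul ?_ ((hHc.tendsto w).comp ((tendsto_approxId w).comp hn))
      refine tendsto_const_nhds.congr' ?_
      filter_upwards [eventually_ge_atTop ⌈‖w‖⌉₊] with m hm
      have : w ∈ Metric.closedBall (0 : Ed d × Ed d) (m : ℝ) := by
        simpa using (Nat.le_ceil _).trans (Nat.cast_le.2 hm)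
      simp only [ham, Set.indicator_of_mem this]
  have hlim3 := hTcont _ _ hlim2 g
  have hlim4 : Tendsto (fun m => ∫ w, am m w * (ρ w * κ w)) atTop
      (𝓝 (T (stfConst γ χ • u) g)) := by
    refine tendsto_of_tendsto_of_dist hlim3 ?_
    exact squeeze_zero (fun m => dist_nonneg) (fun m => (hdist m).le)
      tendsto_one_div_add_atTop_nhds_zero_nat
  have hle4 : ‖T (stfConst γ χ • u) g‖ ≤ ∫ w, B w := by
    refine le_of_tendsto hlim4.norm (Eventually.of_forall fun m => ?_)
    refine norm_integral_le_of_norm_le hB (Eventually.of_forall fun w => ?_)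
    calc _ ≤ ‖a w‖ * ‖ρ w * κ w‖ := by
          rw [norm_mul]
          exact mul_le_mul_of_nonneg_right (norm_indicator_le_norm_self _ _) (norm_nonneg _)
      _ = ‖V w‖ * ‖κ w‖ := by rw [← norm_mul, ← mul_assoc, haρ, norm_mul]
      _ ≤ _ := hle w
  rwa [hTlin.map_smul, _root_.smul_apply, smul_eq_mul, norm_mul] at hle4

/-! ### Tensor products and the kernel -/

lemma iteratedFDeriv_comp_norm_le {E F : Type*} [NormedAddCommGroup E] [NormedSpace ℝ E]
    [NormedAddCommGroup F] [NormedSpace ℝ F] (f : 𝓢(F, ℂ)) {L : E →L[ℝ] F} (hL : ‖L‖ ≤ 1) (n : ℕ)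
    (p : E) : ‖iteratedFDeriv ℝ n (fun q => f (L q)) p‖ ≤ ‖iteratedFDeriv ℝ n f (L p)‖ := by
  have h := L.iteratedFDeriv_comp_right (f.smooth ⊤) p (i := n) (by exact_mod_cast le_top)
  have e : (fun q => f (L q)) = f ∘ L := rfl
  rw [e, h]
  refine (ContinuousMultilinearMap.norm_compContinuousLinearMap_le _ _).trans ?_
  refine mul_le_of_le_one_right (norm_nonneg _) ?_
  exact Finset.prod_le_one (fun _ _ => norm_nonneg _) fun _ _ => hL

/-- The tensor product of two Schwartz functions. -/
def tensor (f g : 𝓢(Ed d, ℂ)) : 𝓢(Ed d × Ed d, ℂ) where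
  toFun p := f p.1 * g p.2
  smooth' := ((f.smooth ⊤).comp contDiff_fst).mul ((g.smooth ⊤).comp contDiff_snd)
  decay' k n := by
    obtain ⟨C, hC, hf⟩ := one_add_pow_mul_norm_iteratedFDeriv_le f k n
    obtain ⟨D, hD, hg⟩ := one_add_pow_mul_norm_iteratedFDeriv_le g k n
    refine ⟨∑ i ∈ Finset.range (n + 1), (n.choose i : ℝ) * (C * D), fun p => ?_⟩
    have h1 := norm_iteratedFDeriv_mul_le (𝕜 := ℝ) (N := ∞)
      ((f.smooth ⊤).comp (contDiff_fst (E := Ed d) (F := Ed d)))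
      ((g.smooth ⊤).comp (contDiff_snd (E := Ed d) (F := Ed d))) p (n := n)
      (by exact_mod_cast le_top)
    have hp : ‖p‖ ^ k ≤ (1 + ‖p.1‖) ^ k * (1 + ‖p.2‖) ^ k := by
      rw [← mul_pow]
      refine pow_le_pow_left₀ (norm_nonneg _) ?_ _
      rw [Prod.norm_def]
      refine max_le ?_ ?_ <;> nlinarith [norm_nonneg p.1, norm_nonneg p.2]
    refine (mul_le_mul hp h1 (norm_nonneg _) (by positivity)).trans ?_
    rw [Finset.mul_sum]
    refine Finset.sum_le_sum fun i hi => ?_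
    have h2 := iteratedFDeriv_comp_norm_le f (L := ContinuousLinearMap.fst ℝ (Ed d) (Ed d))
      (ContinuousLinearMap.norm_fst_le ..) i p
    have h3 := iteratedFDeriv_comp_norm_le g (L := ContinuousLinearMap.snd ℝ (Ed d) (Ed d))
      (ContinuousLinearMap.norm_snd_le ..) (n - i) p
    have h4 := (mul_le_mul_of_nonneg_left h2 (by positivity)).trans
      (hf i (Nat.lt_succ_iff.1 (Finset.mem_range.1 hi)) p.1)
    have h5 := (mul_le_mul_of_nonneg_left h3 (by positivity)).trans
      (hg (n - i) (Nat.sub_le _ _) p.2)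
    have h6 := mul_le_mul_of_nonneg_left (mul_le_mul h4 h5 (by positivity) hC)
      (Nat.cast_nonneg (α := ℝ) (n.choose i))
    refine le_trans (le_of_eq ?_) h6
    simp only [Function.comp_def, ContinuousLinearMap.coe_fst', ContinuousLinearMap.coe_snd']
    ring

/-- The Euclidean inner product on a product space as a continuous bilinear form. -/
def bilProd (d : ℕ) : (Ed d × Ed d) →L[ℝ] (Ed d × Ed d) →L[ℝ] ℝ :=
  (bil d).bilinearComp (ContinuousLinearMap.fst ℝ _ _) (ContinuousLinearMap.fst ℝ _ _) +
    (bil d).bilinearComp (ContinuousLinearMap.snd ℝ _ _) (ContinuousLinearMap.snd ℝ _ _)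

/-- The coordinate change `((x, ξ), (y, η)) ↦ ((x, y), (ξ, -η))` of phase space. -/
def twist (d : ℕ) :
    ((Ed d × Ed d) × (Ed d × Ed d)) →L[ℝ] ((Ed d × Ed d) × (Ed d × Ed d)) :=
  let fs := ContinuousLinearMap.fst ℝ (Ed d × Ed d) (Ed d × Ed d)
  let sn := ContinuousLinearMap.snd ℝ (Ed d × Ed d) (Ed d × Ed d)
  let f := ContinuousLinearMap.fst ℝ (Ed d) (Ed d)
  let s := ContinuousLinearMap.snd ℝ (Ed d) (Ed d)
  ((f.comp fs).prod (f.comp sn)).prod ((s.comp fs).prod (-(s.comp sn)))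

lemma twist_apply (p : (Ed d × Ed d) × (Ed d × Ed d)) :
    twist d p = ((p.1.1, p.2.1), (p.1.2, -p.2.2)) := rfl

lemma norm_twist (p : (Ed d × Ed d) × (Ed d × Ed d)) : ‖twist d p‖ = ‖p‖ := by
  simp only [twist_apply, Prod.norm_def, norm_neg]
  rw [max_max_max_comm]

lemma tf_mul_tf_flipFreq (f g : 𝓢(Ed d, ℂ)) (z w p : Ed d × Ed d) :
    atom (bilProd d) (tensor f g) (twist d (z, w)) p = tf f z p.1 * tf g (flipFreq w) p.2 := by
  have e : Complex.exp (-(Complex.I * ((⟪p.1, z.2⟫ + ⟪p.2, -w.2⟫ : ℝ) : ℂ))) =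
      Complex.exp (-(Complex.I * (⟪p.1, z.2⟫ : ℝ))) *
        Complex.exp (-(Complex.I * (⟪p.2, -w.2⟫ : ℝ))) := by
    rw [← Complex.exp_add, Complex.ofReal_add]
    ring_nf
  change f (p.1 - z.1) * g (p.2 - w.1) *
    Complex.exp (-(Complex.I * ((⟪p.1, z.2⟫ + ⟪p.2, -w.2⟫ : ℝ) : ℂ))) = _
  rw [e, tf_apply, tf_apply]
  simp only [flipFreq]
  ring

lemma stfConst_ne_zero {γ χ : 𝓢(Ed d, ℂ)} (h : ∀ x, χ x = starRingEnd ℂ (γ x))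
    (hγ : (γ : Ed d → ℂ) ≠ 0) : stfConst γ χ ≠ 0 := by
  have e : ∀ t, γ t * χ t = ((‖γ t‖ ^ 2 : ℝ) : ℂ) := fun t => by
    rw [h, Complex.mul_conj, Complex.normSq_eq_norm_sq]
  have hInt : Integrable fun t => ‖γ t‖ ^ 2 := by
    have := (γ.memLp 2 volume).integrable_norm_pow (by norm_num)
    simpa using this
  have hpos : 0 < ∫ t, ‖γ t‖ ^ 2 := by
    rw [integral_pos_iff_support_of_nonneg (fun t => by positivity) hInt]
    obtain ⟨x, hx⟩ := Function.ne_iff.1 hγ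
    refine (IsOpen.measure_pos volume ?_ ⟨x, ?_⟩)
    · exact (γ.continuous.norm.pow 2).isOpen_support
    · simpa using hx
  rw [stfConst]
  simp_rw [e]
  rw [integral_complex_ofReal]
  refine mul_ne_zero ?_ (by exact_mod_cast hpos.ne')
  have := Real.pi_pos
  exact_mod_cast (by positivity : ((2 * Real.pi) ^ Module.finrank ℝ (Ed d) : ℝ) ≠ 0)

lemma IsSTFT.eq_clm_tf {s : ℝ} (hs : 0 < s) {u : TD d} {ψ : Ed d → ℂ} (hψ : GSDecay s ψ)
    {W : Ed d × Ed d → ℂ} (hW : IsSTFT u ψ W) :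
    W = fun z => u (tf (hψ.conj.toSchwartz hs) z) :=
  funext fun z => hW z.1 z.2 _ fun _ => rfl

lemma IsSTFT2.eq_clm_atom {s : ℝ} (hs : 0 < s) {K : TD2 d d} {φ₁ φ₂ : Ed d → ℂ}
    (h₁ : GSDecay s φ₁) (h₂ : GSDecay s φ₂) {W : (Ed d × Ed d) × (Ed d × Ed d) → ℂ}
    (hW : IsSTFT2 K (fun p => φ₁ p.1 * φ₂ p.2) W) :
    W = fun z => K (atom (bilProd d)
      (tensor (h₁.conj.toSchwartz hs) (h₂.conj.toSchwartz hs)) z) := by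
  funext z
  refine hW z.1 z.2 _ fun y => ?_
  rw [map_mul]
  rfl

/-- Local decay of the integrand representing the short-time Fourier transform of `T u`. -/
lemma exists_rayDecay_mul_twist {s : ℝ} (hs : 0 < s) {V : Ed d × Ed d → ℂ}
    {W : (Ed d × Ed d) × (Ed d × Ed d) → ℂ}
    (hV : ∃ (C : ℝ) (k : ℕ), 0 ≤ C ∧ ∀ w, ‖V w‖ ≤ C * (1 + ‖w‖) ^ k)
    (hW : ∃ (C : ℝ) (k : ℕ), 0 ≤ C ∧ ∀ w, ‖W w‖ ≤ C * (1 + ‖w‖) ^ k)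
    (h₁ : ∀ x ξ : Ed d, ((x, (0 : Ed d)), (ξ, (0 : Ed d))) ∉ WFs2 s W)
    (h₂ : ∀ y η : Ed d, (((0 : Ed d), y), ((0 : Ed d), -η)) ∉ WFs2 s W)
    {p : Ed d × Ed d} (hp : p ≠ 0) (h : ∀ z ∈ WFs s V, twist d (p, z) ∉ WFs2 s W)
    {t : ℝ} (ht : 0 ≤ t) (w : Ed d × Ed d) (htw : t ≠ 0 ∨ w ≠ 0) :
    ∃ N ∈ 𝓝 (t • p, w),
      RayDecay (1 / s) (fun q : (Ed d × Ed d) × (Ed d × Ed d) => ‖V q.2‖ * ‖W (twist d q)‖) N := by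
  have hσ : 0 < 1 / s := by positivity
  have hq : (t • p, w) ≠ 0 := by
    rw [Ne, Prod.mk_eq_zero, smul_eq_zero]
    tauto
  have hVp : ∃ (C : ℝ) (k : ℕ), 0 ≤ C ∧
      ∀ q : (Ed d × Ed d) × (Ed d × Ed d), ‖V q.2‖ ≤ C * (1 + ‖q‖) ^ k := by
    obtain ⟨C, k, hC, hk⟩ := hV
    refine ⟨C, k, hC, fun q => (hk q.2).trans ?_⟩
    refine mul_le_mul_of_nonneg_left (pow_le_pow_left₀ (by positivity) ?_ _) hC
    linarith [norm_snd_le q]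
  have hWp : ∃ (C : ℝ) (k : ℕ), 0 ≤ C ∧
      ∀ q : (Ed d × Ed d) × (Ed d × Ed d), ‖W (twist d q)‖ ≤ C * (1 + ‖q‖) ^ k := by
    obtain ⟨C, k, hC, hk⟩ := hW
    refine ⟨C, k, hC, fun q => (hk _).trans ?_⟩
    rw [norm_twist]
  have hdecayW (hmem : twist d (t • p, w) ∉ WFs2 s W) : ∃ N ∈ 𝓝 (t • p, w),
      RayDecay (1 / s)
        (fun q : (Ed d × Ed d) × (Ed d × Ed d) => ‖V q.2‖ * ‖W (twist d q)‖) N := by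
    simp_rw [mul_comm ‖V _‖]
    refine RayDecay.exists_mul_of_poly hσ (fun _ => norm_nonneg _) ?_ hVp
    refine exists_rayDecay_comp (f := fun q => ‖W q‖) (twist d)
      (exists_rayDecay_of_notMem_WFs2 hs ?_ hmem)
    rw [← norm_ne_zero_iff, norm_twist, norm_ne_zero_iff]
    exact hq
  rcases eq_or_ne w 0 with rfl | hw
  · refine hdecayW ?_
    rw [twist_apply]
    simpa using h₁ (t • p).1 (t • p).2
  rcases ht.eq_or_lt with rfl | ht0
  · refine hdecayW ?_
    rw [twist_apply]
    simpa using h₂ w.1 w.2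
  have hw' : t • t⁻¹ • w = w := smul_inv_smul₀ ht0.ne' w
  by_cases hwV : t⁻¹ • w ∈ WFs s V
  · refine hdecayW ?_
    have h3 := smul_notMem_WFs2 ht0 (h _ hwV)
    rwa [← map_smul, Prod.smul_mk, hw'] at h3
  · have h3 := smul_notMem_WFs ht0 hwV
    rw [hw'] at h3
    exact RayDecay.exists_mul_of_poly hσ (fun _ => norm_nonneg _)
      (exists_rayDecay_comp (f := fun q => ‖V q‖)
        (ContinuousLinearMap.snd ℝ (Ed d × Ed d) (Ed d × Ed d))
        (exists_rayDecay_of_notMem_WFs hs hw h3)) hWp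

end GelfandShilov

open GelfandShilov in
theorem statement17 (d : ℕ) (s : ℝ) (hs : 1/2 < s)
    (K : TD2 d d) (T : TD d → TD d) (hTlin : IsLinearMap ℂ T)
    (hTcont : ∀ (useq : ℕ → TD d) (u : TD d),
      (∀ g : SchwartzMap (Ed d) ℂ, Tendsto (fun nn => useq nn g) atTop (nhds (u g))) →
      ∀ g : SchwartzMap (Ed d) ℂ, Tendsto (fun nn => T (useq nn) g) atTop (nhds (T u g)))
    (hker : ∀ f g : SchwartzMap (Ed d) ℂ, (⇑f ∈ SigmaGS s d) → (⇑g ∈ SigmaGS s d) →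
      ∀ uf : TD d, (∀ ψ : SchwartzMap (Ed d) ℂ, uf ψ = ∫ x : Ed d, f x * ψ x) →
      ∀ G : SchwartzMap (Ed d × Ed d) ℂ, (∀ p : Ed d × Ed d, G p = g p.1 * f p.2) →
      T uf g = K G)
    (hmap : ∀ f : SchwartzMap (Ed d) ℂ, ⇑f ∈ SigmaGS s d →
      ∀ uf : TD d, (∀ ψ : SchwartzMap (Ed d) ℂ, uf ψ = ∫ x : Ed d, f x * ψ x) →
      ∃ F : Ed d → ℂ, F ∈ SigmaGS s d ∧
        ∀ ψ : SchwartzMap (Ed d) ℂ, T uf ψ = ∫ x : Ed d, F x * ψ x)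
    (φ1 φ2 ψ1 ψ2 : Ed d → ℂ)
    (hφ1 : φ1 ∈ SigmaGS s d) (hφ10 : φ1 ≠ 0) (hφ2 : φ2 ∈ SigmaGS s d) (hφ20 : φ2 ≠ 0)
    (hψ1 : ψ1 ∈ SigmaGS s d) (hψ10 : ψ1 ≠ 0) (hψ2 : ψ2 ∈ SigmaGS s d) (hψ20 : ψ2 ≠ 0)
    (WK : (Ed d × Ed d) × (Ed d × Ed d) → ℂ)
    (hWK : IsSTFT2 K (fun p => φ1 p.1 * φ2 p.2) WK)
    (hWF1 : ∀ x ξ : Ed d, ((x, (0 : Ed d)), (ξ, (0 : Ed d))) ∉ WFs2 s WK)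
    (hWF2 : ∀ y η : Ed d, (((0 : Ed d), y), ((0 : Ed d), -η)) ∉ WFs2 s WK)
    (u : TD d) (Wu : Ed d × Ed d → ℂ) (hWu : IsSTFT u ψ1 Wu)
    (WTu : Ed d × Ed d → ℂ) (hWTu : IsSTFT (T u) ψ2 WTu) :
    WFs s WTu ⊆
      {p : Ed d × Ed d | ∃ z ∈ WFs s Wu, ((p.1, z.1), (p.2, -z.2)) ∈ WFs2 s WK} := by
  have hs0 : 0 < s := by linarith
  have gφ1 := GSDecay.of_mem_SigmaGS hs0 hφ1
  have gφ2 := GSDecay.of_mem_SigmaGS hs0 hφ2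
  have gψ1 := GSDecay.of_mem_SigmaGS hs0 hψ1
  have gψ2 := GSDecay.of_mem_SigmaGS hs0 hψ2
  have hne : ∀ {f : Ed d → ℂ} (hf : GSDecay s f), f ≠ 0 →
      stfConst (hf.conj.toSchwartz hs0) (hf.toSchwartz hs0) ≠ 0 := fun hf hf0 =>
    stfConst_ne_zero (fun x => (Complex.conj_conj _).symm) fun h =>
      hf0 (funext fun x => (map_eq_zero (starRingEnd ℂ)).1 (congrFun h x))
  set χ := gφ2.conj.toSchwartz hs0
  set γ := gφ2.toSchwartz hs0
  set g := gφ1.conj.toSchwartz hs0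
  have hc : stfConst γ χ ≠ 0 := stfConst_ne_zero (fun x => rfl) hφ20
  have hWKeq := hWK.eq_clm_atom hs0 gφ1 gφ2
  have hWKc : Continuous WK := by
    rw [hWKeq]
    exact K.continuous.comp (continuous_atom _ _)
  have hWKb : ∃ (C : ℝ) (N : ℕ), 0 ≤ C ∧ ∀ w, ‖WK w‖ ≤ C * (1 + ‖w‖) ^ N := by
    rw [hWKeq]
    exact norm_clm_atom_le _ _ _
  intro p hp
  by_contra hcon
  simp only [Set.mem_ofPred_eq, not_exists, not_and] at hcon
  refine absurd hp ?_
  rw [hWTu.eq_clm_tf hs0 gψ2]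
  refine notMem_WFs_of_window_change hs0 (T u) (γ := g) (χ := gφ1.toSchwartz hs0) gφ1 gψ2.conj
    (hne gφ1 hφ10) ?_
  have hV : ∀ z ∈ WFs s (fun w => u (tf γ w)), twist d (p, z) ∉ WFs2 s WK := by
    intro z hz
    refine hcon z ?_
    by_contra hz'
    rw [hWu.eq_clm_tf hs0 gψ1] at hz'
    exact notMem_WFs_of_window_change hs0 u (χ := gψ1.toSchwartz hs0) gψ1 gφ2 (hne gψ1 hψ10)
      hz' hz
  refine notMem_WFs_of_le_integral volume hs0 _
    (fun q => ‖u (tf γ q.2)‖ * ‖WK (twist d q)‖) (fun q => by positivity)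
    ‖stfConst γ χ‖⁻¹ (fun z B hB hle => ?_) fun t ht w htw =>
      exists_rayDecay_mul_twist hs0 (norm_clm_atom_le _ _ _) hWKb hWF1 hWF2 hp.1 hV ht w htw
  rw [← div_eq_inv_mul, le_div_iff₀' (norm_pos_iff.2 hc)]
  refine norm_apply_le_integral_of_majorant hTlin hTcont u γ χ (tf g z)
    (κ := fun w => WK (twist d (z, w))) (fun w => ?_) (by fun_prop) ?_ hB hle
  · rw [hWKeq]
    exact hker _ _ ((GSDecay.tf hs0 gφ2.conj _).mem_SigmaGS hs0)
      ((GSDecay.tf hs0 gφ1.conj _).mem_SigmaGS hs0) _ (pairCLM_apply _) _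
      (tf_mul_tf_flipFreq _ _ _ _)
  · obtain ⟨C, N, hC, hb⟩ := hWKb
    refine ⟨C * (1 + ‖z‖) ^ N, N, by positivity, fun w => (hb _).trans ?_⟩
    rw [norm_twist, mul_assoc, ← mul_pow]
    refine mul_le_mul_of_nonneg_left (pow_le_pow_left₀ (by positivity) ?_ _) hC
    have := max_le_add_of_nonneg (norm_nonneg z) (norm_nonneg w)
    rw [Prod.norm_mk]
    nlinarith [norm_nonneg z, norm_nonneg w]

end
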